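/- arXiv:1505.07755 — 12 statements merged into one kernel-verified Lean document; each statement's English description precedes it below -/
import Mathlib

section
/- Let L ≤ M ≤ N be natural numbers and let U, V be M×N real matrices with U·Uᵀ·U = U, V·Vᵀ·V = V and trace(U·Uᵀ) = trace(V·Vᵀ) = L. Then there exist A in the orthogonal group O(M) and B in the orthogonal group O(N) such that V = A·U·Bᵀ. (Together with the fact that A·U·Bᵀ again satisfies these relations, this says that the action of O(M)×O(N) on O_{MN}^L given by (A,B)·U = A·U·Bᵀ is well defined and transitive.) -/
open Matrix

/-- Two real partial isometries with the same left projection differ by an orthogonal matrix acting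
on the right. -/
theorem exists_orthogonal_eq_mul_transpose {m n : Type*} [Fintype m] [Fintype n] [DecidableEq m]
    [DecidableEq n] (U V : Matrix m n ℝ) (h : U * Uᵀ = V * Vᵀ) (hV : V * Vᵀ * V = V) :
    ∃ B ∈ Matrix.orthogonalGroup n ℝ, V = U * Bᵀ := by
  have hVt : Vᵀ * U * Uᵀ = Vᵀ := by
    rw [Matrix.mul_assoc, h]
    simpa [Matrix.mul_assoc] using congrArg transpose hV
  let T := toEuclideanLin (Vᵀ * U)
  let S := toEuclideanLin Uᵀ
  have hTS (x) : T (S x) = toEuclideanLin Vᵀ x := by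
    simp only [T, S, toLpLin_apply, mulVec_mulVec, hVt]
  have hnorm (W : Matrix m n ℝ) (x : EuclideanSpace ℝ m) :
      ‖toEuclideanLin Wᵀ x‖ ^ 2 = x.ofLp ⬝ᵥ ((W * Wᵀ) *ᵥ x.ofLp) := by
    rw [← real_inner_self_eq_norm_sq, EuclideanSpace.inner_eq_star_dotProduct]
    simp only [toLpLin_apply, star_trivial]
    rw [← mulVec_mulVec, mulVec_transpose, dotProduct_mulVec]
  let L : LinearMap.range S →ₗᵢ[ℝ] EuclideanSpace ℝ n :=
    { toLinearMap := T.domRestrict (LinearMap.range S)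
      norm_map' := by
        rintro ⟨_, x, rfl⟩
        simp only [LinearMap.domRestrict_apply, hTS, Submodule.coe_norm]
        rw [← sq_eq_sq₀ (norm_nonneg _) (norm_nonneg _), hnorm, hnorm, h] }
  let E : EuclideanSpace ℝ n ≃ₗᵢ[ℝ] EuclideanSpace ℝ n := L.extend.toLinearIsometryEquiv rfl
  let b := EuclideanSpace.basisFun n ℝ
  have hE (x) : E (S x) = toEuclideanLin Vᵀ x := by
    rw [← hTS]
    exact L.extend_apply ⟨S x, x, rfl⟩
  refine ⟨E.toMatrix b.toBasis b.toBasis, E.toMatrix_mem_unitaryGroup b b, ?_⟩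
  have hB : toEuclideanLin (E.toMatrix b.toBasis b.toBasis) = E.toLinearMap := by
    rw [toEuclideanLin_eq_toLin_orthonormal]
    exact Matrix.toLin_toMatrix _ _ _
  rw [← transpose_inj, transpose_mul, transpose_transpose]
  refine toEuclideanLin.injective (LinearMap.ext fun x => ?_)
  rw [toLpLin_mul_same, hB]
  exact (hE x).symm

/-- Two antitone functions on a finite linear order with values in `{0, 1}` and the same sum
coincide. -/
theorem Antitone.eq_of_zero_or_one_of_sum_eq {ι : Type*} [Fintype ι] [LinearOrder ι] {f g : ι → ℝ}
    (hf : Antitone f) (hg : Antitone g) (hf01 : ∀ i, f i = 0 ∨ f i = 1)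
    (hg01 : ∀ i, g i = 0 ∨ g i = 1) (h : ∑ i, f i = ∑ i, g i) : f = g := by
  have key : f ≤ g ∨ g ≤ f := by
    by_contra! hcon
    simp only [Pi.le_def, not_forall, not_le] at hcon
    obtain ⟨⟨i, hi⟩, j, hj⟩ := hcon
    rcases le_total i j with hij | hij
    · have := hg hij
      rcases hf01 i with a | a <;> rcases hf01 j with b | b <;> rcases hg01 i with c | c <;>
        rcases hg01 j with d | d <;> linarith
    · have := hf hij
      rcases hf01 i with a | a <;> rcases hf01 j with b | b <;> rcases hg01 i with c | c <;>
        rcases hg01 j with d | d <;> linarith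
  rcases key with k | k
  · funext i
    exact (Finset.sum_eq_sum_iff_of_le fun i _ => k i).1 h i (Finset.mem_univ i)
  · funext i
    exact ((Finset.sum_eq_sum_iff_of_le fun i _ => k i).1 h.symm i (Finset.mem_univ i)).symm

theorem Matrix.IsHermitian.eigenvalues_eq_zero_or_one {n : Type*} [Fintype n] [DecidableEq n]
    {P : Matrix n n ℝ} (hP : P.IsHermitian) (hPP : IsIdempotentElem P) (i : n) :
    hP.eigenvalues i = 0 ∨ hP.eigenvalues i = 1 := by
  simpa using hPP.spectrum_subset ℝ (hP.eigenvalues_mem_spectrum_real i)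

/-- Real orthogonal projections with the same trace are orthogonally conjugate. -/
theorem exists_orthogonal_conj_of_trace_eq {n : Type*} [Fintype n] [DecidableEq n]
    {P Q : Matrix n n ℝ} (hP : P.IsHermitian) (hQ : Q.IsHermitian) (hPP : IsIdempotentElem P)
    (hQQ : IsIdempotentElem Q) (h : P.trace = Q.trace) :
    ∃ A ∈ Matrix.orthogonalGroup n ℝ, Q = A * P * Aᵀ := by
  let e : Fin (Fintype.card n) ≃ n := Fintype.equivOfCardEq (Fintype.card_fin _)
  have hval {R : Matrix n n ℝ} (hR : R.IsHermitian) (j) :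
      hR.eigenvalues₀ j = hR.eigenvalues (e j) := by
    simp [Matrix.IsHermitian.eigenvalues, e]
  have heig₀ : hP.eigenvalues₀ = hQ.eigenvalues₀ := by
    refine hP.eigenvalues₀_antitone.eq_of_zero_or_one_of_sum_eq hQ.eigenvalues₀_antitone
      (fun j => ?_) (fun j => ?_) ?_
    · rw [hval]
      exact hP.eigenvalues_eq_zero_or_one hPP _
    · rw [hval]
      exact hQ.eigenvalues_eq_zero_or_one hQQ _
    · simp only [hval]
      rw [e.sum_comp hP.eigenvalues, e.sum_comp hQ.eigenvalues]
      simpa [hP.trace_eq_sum_eigenvalues, hQ.trace_eq_sum_eigenvalues] using h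
  have heig : hP.eigenvalues = hQ.eigenvalues := by
    unfold Matrix.IsHermitian.eigenvalues
    rw [heig₀]
  let A := hQ.eigenvectorUnitary * star hP.eigenvectorUnitary
  have hA : Q = Unitary.conjStarAlgAut ℝ _ A P := by
    rw [Unitary.conjStarAlgAut_mul_apply, hP.conjStarAlgAut_star_eigenvectorUnitary, heig]
    exact hQ.spectral_theorem
  refine ⟨A, A.2, ?_⟩
  simpa [Unitary.conjStarAlgAut_apply, star_eq_conjTranspose] using! hA

/-- The action of O(M)×O(N) on the space `O_{MN}^L` of rank-`L` real partial
isometries, given by `(A,B)·U = A·U·Bᵀ`, is transitive: any two elements `U, V` of `O_{MN}^L`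
are related by `V = A * U * Bᵀ` for some orthogonal matrices `A ∈ O(M)`, `B ∈ O(N)`. -/
theorem stmt_2 (L M N : ℕ) (hLM : L ≤ M) (hMN : M ≤ N)
    (U V : Matrix (Fin M) (Fin N) ℝ)
    (hU : U * Uᵀ * U = U) (hV : V * Vᵀ * V = V)
    (htU : (U * Uᵀ).trace = (L : ℝ)) (htV : (V * Vᵀ).trace = (L : ℝ)) :
    ∃ A ∈ Matrix.orthogonalGroup (Fin M) ℝ, ∃ B ∈ Matrix.orthogonalGroup (Fin N) ℝ,
      V = A * U * Bᵀ := by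
  have hherm (W : Matrix (Fin M) (Fin N) ℝ) : (W * Wᵀ).IsHermitian := by
    simpa using isHermitian_mul_conjTranspose_self W
  have hidem (W : Matrix (Fin M) (Fin N) ℝ) (hW : W * Wᵀ * W = W) :
      IsIdempotentElem (W * Wᵀ) := by
    rw [IsIdempotentElem, ← Matrix.mul_assoc, hW]
  obtain ⟨A, hA, hAP⟩ := exists_orthogonal_conj_of_trace_eq (hherm U) (hherm V) (hidem U hU)
    (hidem V hV) (htU.trans htV.symm)
  obtain ⟨B, hB, hBV⟩ := exists_orthogonal_eq_mul_transpose (A * U) V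
    (by rw [hAP, transpose_mul]; simp only [Matrix.mul_assoc]) hV
  exact ⟨A, hA, B, hB, hBV⟩
end

section
/- Let L ≤ M ≤ N be natural numbers and let J be the M×N real matrix given in block form by fromBlocks 1 0 0 0, with upper-left block the L×L identity (using the identifications Fin M ≃ Fin L ⊕ Fin (M−L) and Fin N ≃ Fin L ⊕ Fin (N−L)). For A ∈ O(M) and B ∈ O(N), one has A·J·Bᵀ = J if and only if there exist x ∈ O(L), a ∈ O(M−L), b ∈ O(N−L) such that A = fromBlocks x 0 0 a and B = fromBlocks x 0 0 b. Consequently, the stabilizer of J in O(M)×O(N) under the action (A,B)·U = A·U·Bᵀ is the range of the injective group homomorphism O(L)×O(M−L)×O(N−L) → O(M)×O(N), (x,a,b) ↦ (fromBlocks x 0 0 a, fromBlocks x 0 0 b), hence is isomorphic to O(L)×O(M−L)×O(N−L). -/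
open Matrix

namespace Matrix

variable {l m n R : Type*} [Fintype l] [Fintype m] [Fintype n] [DecidableEq l] [DecidableEq n]
  [CommRing R]

/-- For `B` orthogonal, `U ↦ A * U * Bᵀ` fixes `J` exactly when `A` and `B` intertwine `J`. -/
theorem mul_mul_transpose_eq_iff_of_mem_orthogonalGroup {A : Matrix m m R} {B : Matrix n n R}
    (hB : B ∈ orthogonalGroup n R) (J : Matrix m n R) :
    A * J * Bᵀ = J ↔ A * J = J * B := by
  have hB₁ : B * Bᵀ = 1 := (mem_orthogonalGroup_iff n R).mp hB
  have hB₂ : Bᵀ * B = 1 := mul_eq_one_comm.mp hB₁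
  constructor <;> intro h
  · calc A * J = A * J * Bᵀ * B := by rw [Matrix.mul_assoc _ Bᵀ, hB₂, Matrix.mul_one]
      _ = J * B := by rw [h]
  · rw [h, Matrix.mul_assoc, hB₁, Matrix.mul_one]

variable [DecidableEq m]

theorem fromBlocks_diagonal_mem_orthogonalGroup_iff {x : Matrix l l R} {a : Matrix m m R} :
    fromBlocks x 0 0 a ∈ orthogonalGroup (l ⊕ m) R ↔
      x ∈ orthogonalGroup l R ∧ a ∈ orthogonalGroup m R := by
  simp [mem_orthogonalGroup_iff, fromBlocks_transpose, fromBlocks_multiply, ← fromBlocks_one,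
    fromBlocks_inj]

/-- A block upper triangular orthogonal matrix is block diagonal. -/
theorem toBlocks₁₂_eq_zero_of_mem_orthogonalGroup {x : Matrix l l R} {p : Matrix l m R}
    {a : Matrix m m R} (h : fromBlocks x p 0 a ∈ orthogonalGroup (l ⊕ m) R) : p = 0 := by
  simp only [mem_orthogonalGroup_iff, fromBlocks_transpose, fromBlocks_multiply,
    ← fromBlocks_one, fromBlocks_inj, transpose_zero, Matrix.mul_zero, zero_add] at h
  obtain ⟨-, hpa, -, ha⟩ := h
  calc p = p * (aᵀ * a) := by rw [mul_eq_one_comm.mp ha, Matrix.mul_one]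
    _ = 0 := by rw [← Matrix.mul_assoc, hpa, Matrix.zero_mul]

/-- A block lower triangular orthogonal matrix is block diagonal. -/
theorem toBlocks₂₁_eq_zero_of_mem_orthogonalGroup {x : Matrix l l R} {q : Matrix m l R}
    {a : Matrix m m R} (h : fromBlocks x 0 q a ∈ orthogonalGroup (l ⊕ m) R) : q = 0 := by
  have h' : fromBlocks xᵀ qᵀ 0 aᵀ ∈ orthogonalGroup (l ⊕ m) R := by
    rw [mem_orthogonalGroup_iff'] at h
    simpa [mem_orthogonalGroup_iff, fromBlocks_transpose] using h
  exact transpose_eq_zero.mp (toBlocks₁₂_eq_zero_of_mem_orthogonalGroup h')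

theorem mul_fromBlocks_one_mul_transpose_eq_iff
    {A : Matrix (l ⊕ m) (l ⊕ m) R} {B : Matrix (l ⊕ n) (l ⊕ n) R}
    (hA : A ∈ orthogonalGroup (l ⊕ m) R) (hB : B ∈ orthogonalGroup (l ⊕ n) R) :
    A * (fromBlocks 1 0 0 0 : Matrix (l ⊕ m) (l ⊕ n) R) * Bᵀ = fromBlocks 1 0 0 0 ↔
      ∃ x ∈ orthogonalGroup l R, ∃ a ∈ orthogonalGroup m R, ∃ b ∈ orthogonalGroup n R,
        A = fromBlocks x 0 0 a ∧ B = fromBlocks x 0 0 b := by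
  rw [mul_mul_transpose_eq_iff_of_mem_orthogonalGroup hB]
  constructor
  · intro h
    obtain ⟨x, p, q, a, rfl⟩ : ∃ x p q a, A = fromBlocks x p q a :=
      ⟨_, _, _, _, (fromBlocks_toBlocks A).symm⟩
    obtain ⟨y, r, s, b, rfl⟩ : ∃ y r s b, B = fromBlocks y r s b :=
      ⟨_, _, _, _, (fromBlocks_toBlocks B).symm⟩
    simp only [fromBlocks_multiply, fromBlocks_inj, Matrix.mul_one, Matrix.one_mul,
      Matrix.mul_zero, Matrix.zero_mul, add_zero] at h
    obtain ⟨rfl, hr, rfl, -⟩ := h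
    subst hr
    obtain rfl := toBlocks₁₂_eq_zero_of_mem_orthogonalGroup hA
    obtain rfl := toBlocks₂₁_eq_zero_of_mem_orthogonalGroup hB
    obtain ⟨hx, ha⟩ := fromBlocks_diagonal_mem_orthogonalGroup_iff.mp hA
    exact ⟨x, hx, a, ha, b, (fromBlocks_diagonal_mem_orthogonalGroup_iff.mp hB).2, rfl, rfl⟩
  · rintro ⟨x, -, a, -, b, -, rfl, rfl⟩
    simp [fromBlocks_multiply]

end Matrix

/-- With `J = fromBlocks 1 0 0 0` (upper-left block the L×L identity, using the
identifications `Fin M ≃ Fin L ⊕ Fin (M-L)` and `Fin N ≃ Fin L ⊕ Fin (N-L)`), a pair of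
orthogonal matrices `(A, B)` stabilizes `J` (i.e. `A * J * Bᵀ = J`) iff `A = fromBlocks x 0 0 a`
and `B = fromBlocks x 0 0 b` for some `x ∈ O(L)`, `a ∈ O(M-L)`, `b ∈ O(N-L)`.  Moreover the map
`(x,a,b) ↦ (fromBlocks x 0 0 a, fromBlocks x 0 0 b)` is injective and multiplicative, so the
stabilizer of `J` is (the range of an injective group homomorphism from, hence isomorphic to)
`O(L) × O(M-L) × O(N-L)`. -/
theorem stmt_3 (L M N : ℕ) (hLM : L ≤ M) (hMN : M ≤ N)
    (J : Matrix (Fin L ⊕ Fin (M - L)) (Fin L ⊕ Fin (N - L)) ℝ)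
    (hJ : J = Matrix.fromBlocks 1 0 0 0) :
    (∀ (A : Matrix (Fin L ⊕ Fin (M - L)) (Fin L ⊕ Fin (M - L)) ℝ)
        (B : Matrix (Fin L ⊕ Fin (N - L)) (Fin L ⊕ Fin (N - L)) ℝ),
      A ∈ Matrix.orthogonalGroup (Fin L ⊕ Fin (M - L)) ℝ →
      B ∈ Matrix.orthogonalGroup (Fin L ⊕ Fin (N - L)) ℝ →
      (A * J * Bᵀ = J ↔
        ∃ x ∈ Matrix.orthogonalGroup (Fin L) ℝ,
        ∃ a ∈ Matrix.orthogonalGroup (Fin (M - L)) ℝ,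
        ∃ b ∈ Matrix.orthogonalGroup (Fin (N - L)) ℝ,
          A = Matrix.fromBlocks x 0 0 a ∧ B = Matrix.fromBlocks x 0 0 b)) ∧
    Function.Injective
      (fun p : Matrix (Fin L) (Fin L) ℝ × Matrix (Fin (M - L)) (Fin (M - L)) ℝ ×
          Matrix (Fin (N - L)) (Fin (N - L)) ℝ =>
        (Matrix.fromBlocks p.1 0 0 p.2.1, Matrix.fromBlocks p.1 0 0 p.2.2)) ∧
    (∀ (K : ℕ) (x x' : Matrix (Fin L) (Fin L) ℝ) (a a' : Matrix (Fin K) (Fin K) ℝ),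
      Matrix.fromBlocks x 0 0 a * Matrix.fromBlocks x' 0 0 a' =
        Matrix.fromBlocks (x * x') 0 0 (a * a')) := by
  subst hJ
  refine ⟨fun A B hA hB => mul_fromBlocks_one_mul_transpose_eq_iff hA hB, ?_, ?_⟩
  · rintro ⟨x, a, b⟩ ⟨x', a', b'⟩ h
    simp only [Prod.mk.injEq, fromBlocks_inj] at h ⊢
    exact ⟨h.1.1, h.1.2.2.2, h.2.2.2.2⟩
  · intro K x x' a a'
    simp [fromBlocks_multiply]
end

section
/- Let L ≤ M ≤ N be natural numbers and let U, V be M×N complex matrices with U·Uᴴ·U = U, V·Vᴴ·V = V and trace(U·Uᴴ) = trace(V·Vᴴ) = L. Then there exist A in the unitary group U(M) and B in the unitary group U(N) such that V = A·U·Bᴴ. (Together with the fact that A·U·Bᴴ again satisfies these relations, this says that the action of U(M)×U(N) on U_{MN}^L given by (A,B)·U = A·U·Bᴴ is well defined and transitive.) -/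
open Matrix

/-- The rank of an idempotent matrix equals its trace. -/
theorem Matrix.trace_eq_rank_of_isIdempotentElem {n K : Type*} [Fintype n] [DecidableEq n]
    [Field K] {P : Matrix n n K} (hP : IsIdempotentElem P) : P.trace = (P.rank : K) := by
  have h : IsIdempotentElem (Matrix.toLin' P) := by
    rw [IsIdempotentElem, Module.End.mul_eq_comp, ← Matrix.toLin'_mul, hP.eq]
  rw [← Matrix.trace_toLin'_eq, (LinearMap.IsIdempotentElem.isProj_range _ h).trace]
  rfl

/-- A matrix has orthonormal columns iff its Gram matrix is the identity. -/
theorem Matrix.orthonormal_col_iff {m k : Type*} [Fintype m] [Fintype k] [DecidableEq k]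
    (X : Matrix m k ℂ) :
    Orthonormal ℂ (fun j => WithLp.toLp 2 (X.col j) : k → EuclideanSpace ℂ m) ↔ Xᴴ * X = 1 := by
  rw [orthonormal_iff_ite, ← Matrix.ext_iff]
  refine forall₂_congr fun i j => ?_
  rw [EuclideanSpace.inner_eq_star_dotProduct, Matrix.mul_apply, Matrix.one_apply]
  simp [dotProduct, mul_comm]

/-- A matrix with orthonormal columns can be completed to a unitary matrix. -/
theorem Matrix.exists_unitary_submatrix_eq {m k : Type*} [Fintype m] [DecidableEq m] [Fintype k]
    [DecidableEq k] (X : Matrix m k ℂ) (hX : Xᴴ * X = 1) (f : k ↪ m) :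
    ∃ Q ∈ Matrix.unitaryGroup m ℂ, Q.submatrix id f = X := by
  rw [← Matrix.orthonormal_col_iff] at hX
  let v : m → EuclideanSpace ℂ m :=
    Function.extend f (fun j => WithLp.toLp 2 (X.col j)) 0
  have hvf (j : k) : v (f j) = WithLp.toLp 2 (X.col j) := f.injective.extend_apply _ _ _
  have hv : Orthonormal ℂ ((Set.range f).domRestrict v) := by
    let e := Equiv.ofInjective f f.injective
    have h : (Set.range f).domRestrict v = (fun j => WithLp.toLp 2 (X.col j)) ∘ e.symm := by
      ext1 i
      obtain ⟨j, rfl⟩ := e.surjective i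
      rw [Function.comp_apply, e.symm_apply_apply]
      exact hvf j
    rw [h]
    exact hX.comp _ e.symm.injective
  obtain ⟨b, hb⟩ := hv.exists_orthonormalBasis_extension_of_card_eq (by simp)
  refine ⟨Matrix.of fun i j => b j i, ?_, ?_⟩
  · rw [Matrix.mem_unitaryGroup_iff', Matrix.star_eq_conjTranspose,
      ← Matrix.orthonormal_col_iff]
    exact b.orthonormal
  · ext i j
    simp [hb (f j) ⟨j, rfl⟩, hvf]

/-- The unitary group acts transitively on matrices with orthonormal columns. -/
theorem Matrix.exists_unitary_mul_eq {m k : Type*} [Fintype m] [DecidableEq m] [Fintype k]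
    [DecidableEq k] (X Y : Matrix m k ℂ) (hX : Xᴴ * X = 1) (hY : Yᴴ * Y = 1) (f : k ↪ m) :
    ∃ A ∈ Matrix.unitaryGroup m ℂ, A * X = Y := by
  obtain ⟨Q, hQ, rfl⟩ := X.exists_unitary_submatrix_eq hX f
  obtain ⟨R, hR, rfl⟩ := Y.exists_unitary_submatrix_eq hY f
  refine ⟨R * star Q, mul_mem hR (Unitary.star_mem hQ), ?_⟩
  have h : (R * star Q) * Q = R := by
    rw [mul_assoc, Matrix.mem_unitaryGroup_iff'.mp hQ, mul_one]
  ext i j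
  exact congrFun (congrFun h i) (f j)

/-- The column space of a matrix of rank `L` has an orthonormal basis of `L` vectors. -/
theorem Matrix.exists_orthonormal_col_factorization {m n : Type*} [Fintype m] [Fintype n]
    [DecidableEq n] {L : ℕ} (U : Matrix m n ℂ) (hU : U.rank = L) :
    ∃ (X : Matrix m (Fin L) ℂ) (C : Matrix (Fin L) n ℂ) (D : Matrix n (Fin L) ℂ),
      Xᴴ * X = 1 ∧ U = X * C ∧ X = U * D := by
  classical
  let S := LinearMap.range (Matrix.toEuclideanLin U)
  have hS : Module.finrank ℂ S = L := by
    rw [← hU, U.rank_eq_finrank_range_toLin (PiLp.basisFun 2 ℂ m) (PiLp.basisFun 2 ℂ n),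
      ← Matrix.toLpLin_eq_toLin]
  let b := (stdOrthonormalBasis ℂ S).reindex (finCongr hS)
  have hD (j : Fin L) : ∃ d, Matrix.toEuclideanLin U d = (b j : EuclideanSpace ℂ m) := (b j).2
  choose d hd using hD
  let c (j : n) : S := ⟨Matrix.toEuclideanLin U (EuclideanSpace.single j 1), ⟨_, rfl⟩⟩
  refine ⟨Matrix.of fun i j => (b j : EuclideanSpace ℂ m) i,
    Matrix.of fun i j => b.repr (c j) i, Matrix.of fun i j => d j i, ?_, ?_, ?_⟩
  · rw [← Matrix.orthonormal_col_iff]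
    exact b.orthonormal.comp_linearIsometry S.subtypeₗᵢ
  · ext i j
    have h := congrArg (fun x : S => (x : EuclideanSpace ℂ m) i) (b.sum_repr (c j))
    simp only [Submodule.coe_sum, Submodule.coe_smul, WithLp.ofLp_sum, Finset.sum_apply] at h
    simpa [c, Matrix.mul_apply, mul_comm] using h.symm
  · ext i j
    simp [← hd j, Matrix.mul_apply, Matrix.mulVec, dotProduct]

/-- A partial isometry of rank `L` factors as `X * Zᴴ`, where `X` and `Z` both have `L`
orthonormal columns. -/
theorem Matrix.exists_isometry_factorization {m n : Type*} [Fintype m] [DecidableEq m]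
    [Fintype n] [DecidableEq n] {L : ℕ} (U : Matrix m n ℂ) (hU : U * Uᴴ * U = U)
    (ht : (U * Uᴴ).trace = (L : ℂ)) :
    ∃ (X : Matrix m (Fin L) ℂ) (Z : Matrix n (Fin L) ℂ),
      Xᴴ * X = 1 ∧ Zᴴ * Z = 1 ∧ U = X * Zᴴ := by
  have hidem : IsIdempotentElem (U * Uᴴ) := by
    rw [IsIdempotentElem, ← Matrix.mul_assoc, hU]
  have hrank : (U * Uᴴ).rank = U.rank :=
    (Matrix.rank_mul_le_left _ _).antisymm (by simpa [hU] using Matrix.rank_mul_le_left (U * Uᴴ) U)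
  rw [Matrix.trace_eq_rank_of_isIdempotentElem hidem, hrank, Nat.cast_inj] at ht
  obtain ⟨X, C, D, hX, hC, hD⟩ := U.exists_orthonormal_col_factorization ht
  refine ⟨X, Cᴴ, hX, ?_, by rwa [Matrix.conjTranspose_conjTranspose]⟩
  have hUX : U * Uᴴ * X = X := by rw [hD, ← Matrix.mul_assoc, hU]
  have hCX : C = Xᴴ * U := by rw [hC, ← Matrix.mul_assoc, hX, Matrix.one_mul]
  calc Cᴴᴴ * Cᴴ = Xᴴ * (U * Uᴴ * X) := by
        rw [Matrix.conjTranspose_conjTranspose, hCX, Matrix.conjTranspose_mul,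
          Matrix.conjTranspose_conjTranspose]
        simp only [Matrix.mul_assoc]
    _ = 1 := by rw [hUX, hX]

/-- The action of U(M)×U(N) on the space `U_{MN}^L` of rank-`L` complex partial
isometries, given by `(A,B)·U = A·U·Bᴴ`, is transitive: any two elements `U, V` of `U_{MN}^L`
are related by `V = A * U * Bᴴ` for some unitary matrices `A ∈ U(M)`, `B ∈ U(N)`. -/
theorem stmt_4 (L M N : ℕ) (hLM : L ≤ M) (hMN : M ≤ N)
    (U V : Matrix (Fin M) (Fin N) ℂ)
    (hU : U * Uᴴ * U = U) (hV : V * Vᴴ * V = V)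
    (htU : (U * Uᴴ).trace = (L : ℂ)) (htV : (V * Vᴴ).trace = (L : ℂ)) :
    ∃ A ∈ Matrix.unitaryGroup (Fin M) ℂ, ∃ B ∈ Matrix.unitaryGroup (Fin N) ℂ,
      V = A * U * Bᴴ := by
  obtain ⟨X, Z, hX, hZ, rfl⟩ := U.exists_isometry_factorization hU htU
  obtain ⟨Y, W, hY, hW, rfl⟩ := V.exists_isometry_factorization hV htV
  obtain ⟨A, hA, rfl⟩ := X.exists_unitary_mul_eq Y hX hY (Fin.castLEEmb hLM)
  obtain ⟨B, hB, rfl⟩ := Z.exists_unitary_mul_eq W hZ hW (Fin.castLEEmb (hLM.trans hMN))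
  refine ⟨A, hA, B, hB, ?_⟩
  simp only [Matrix.conjTranspose_mul, Matrix.mul_assoc]
end

section
/- Let L ≤ M ≤ N be natural numbers and let J be the M×N complex matrix given in block form by fromBlocks 1 0 0 0, with upper-left block the L×L identity (using the identifications Fin M ≃ Fin L ⊕ Fin (M−L) and Fin N ≃ Fin L ⊕ Fin (N−L)). For A ∈ U(M) and B ∈ U(N), one has A·J·Bᴴ = J if and only if there exist x ∈ U(L), a ∈ U(M−L), b ∈ U(N−L) such that A = fromBlocks x 0 0 a and B = fromBlocks x 0 0 b. Consequently, the stabilizer of J in U(M)×U(N) under the action (A,B)·U = A·U·Bᴴ is the range of the injective group homomorphism U(L)×U(M−L)×U(N−L) → U(M)×U(N), (x,a,b) ↦ (fromBlocks x 0 0 a, fromBlocks x 0 0 b), hence is isomorphic to U(L)×U(M−L)×U(N−L). -/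
open Matrix

namespace Matrix

variable {m n : Type*} [Fintype m] [Fintype n] [DecidableEq n]
  {α : Type*} [CommRing α] [StarRing α]

theorem mul_mul_conjTranspose_eq_iff_of_mem_unitaryGroup {A : Matrix m m α} {B : Matrix n n α}
    (hB : B ∈ unitaryGroup n α) {J : Matrix m n α} : A * J * Bᴴ = J ↔ A * J = J * B := by
  have h₁ : B * Bᴴ = 1 := mem_unitaryGroup_iff.mp hB
  have h₂ : Bᴴ * B = 1 := mem_unitaryGroup_iff'.mp hB
  constructor <;> intro h
  · conv_rhs => rw [← h, Matrix.mul_assoc, h₂, Matrix.mul_one]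
  · rw [h, Matrix.mul_assoc, h₁, Matrix.mul_one]

variable [DecidableEq m]

theorem fromBlocks_diagonal_mem_unitaryGroup_iff {x : Matrix m m α} {a : Matrix n n α} :
    fromBlocks x 0 0 a ∈ unitaryGroup (m ⊕ n) α ↔
      x ∈ unitaryGroup m α ∧ a ∈ unitaryGroup n α := by
  simp only [mem_unitaryGroup_iff, star_eq_conjTranspose, fromBlocks_conjTranspose,
    fromBlocks_multiply, ← fromBlocks_one, fromBlocks_inj]
  simp

theorem lowerLeft_eq_zero_of_fromBlocks_mem_unitaryGroup {p : Matrix m m α} {r : Matrix n m α}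
    {s : Matrix n n α} (h : fromBlocks p 0 r s ∈ unitaryGroup (m ⊕ n) α) : r = 0 := by
  rw [mem_unitaryGroup_iff, star_eq_conjTranspose, fromBlocks_conjTranspose,
    fromBlocks_multiply, ← fromBlocks_one, fromBlocks_inj] at h
  simp only [conjTranspose_zero, Matrix.mul_zero, Matrix.zero_mul, add_zero] at h
  obtain ⟨hp, -, hr, -⟩ := h
  calc r = r * (pᴴ * p) := by rw [mul_eq_one_comm.mp hp, Matrix.mul_one]
    _ = 0 := by rw [← Matrix.mul_assoc, hr, Matrix.zero_mul]

theorem upperRight_eq_zero_of_fromBlocks_mem_unitaryGroup {p : Matrix m m α} {q : Matrix m n α}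
    {s : Matrix n n α} (h : fromBlocks p q 0 s ∈ unitaryGroup (m ⊕ n) α) : q = 0 := by
  have h' := Unitary.star_mem h
  rw [star_eq_conjTranspose, fromBlocks_conjTranspose, conjTranspose_zero] at h'
  exact conjTranspose_eq_zero.mp (lowerLeft_eq_zero_of_fromBlocks_mem_unitaryGroup h')

end Matrix

/-- With `J = fromBlocks 1 0 0 0` (upper-left block the L×L identity, using the
identifications `Fin M ≃ Fin L ⊕ Fin (M-L)` and `Fin N ≃ Fin L ⊕ Fin (N-L)`), a pair of unitary
matrices `(A, B)` stabilizes `J` (i.e. `A * J * Bᴴ = J`) iff `A = fromBlocks x 0 0 a` and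
`B = fromBlocks x 0 0 b` for some `x ∈ U(L)`, `a ∈ U(M-L)`, `b ∈ U(N-L)`.  Moreover the map
`(x,a,b) ↦ (fromBlocks x 0 0 a, fromBlocks x 0 0 b)` is injective and multiplicative, so the
stabilizer of `J` is (the range of an injective group homomorphism from, hence isomorphic to)
`U(L) × U(M-L) × U(N-L)`. -/
theorem stmt_5 (L M N : ℕ) (hLM : L ≤ M) (hMN : M ≤ N)
    (J : Matrix (Fin L ⊕ Fin (M - L)) (Fin L ⊕ Fin (N - L)) ℂ)
    (hJ : J = Matrix.fromBlocks 1 0 0 0) :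
    (∀ (A : Matrix (Fin L ⊕ Fin (M - L)) (Fin L ⊕ Fin (M - L)) ℂ)
        (B : Matrix (Fin L ⊕ Fin (N - L)) (Fin L ⊕ Fin (N - L)) ℂ),
      A ∈ Matrix.unitaryGroup (Fin L ⊕ Fin (M - L)) ℂ →
      B ∈ Matrix.unitaryGroup (Fin L ⊕ Fin (N - L)) ℂ →
      (A * J * Bᴴ = J ↔
        ∃ x ∈ Matrix.unitaryGroup (Fin L) ℂ,
        ∃ a ∈ Matrix.unitaryGroup (Fin (M - L)) ℂ,
        ∃ b ∈ Matrix.unitaryGroup (Fin (N - L)) ℂ,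
          A = Matrix.fromBlocks x 0 0 a ∧ B = Matrix.fromBlocks x 0 0 b)) ∧
    Function.Injective
      (fun p : Matrix (Fin L) (Fin L) ℂ × Matrix (Fin (M - L)) (Fin (M - L)) ℂ ×
          Matrix (Fin (N - L)) (Fin (N - L)) ℂ =>
        (Matrix.fromBlocks p.1 0 0 p.2.1, Matrix.fromBlocks p.1 0 0 p.2.2)) ∧
    (∀ (K : ℕ) (x x' : Matrix (Fin L) (Fin L) ℂ) (a a' : Matrix (Fin K) (Fin K) ℂ),
      Matrix.fromBlocks x 0 0 a * Matrix.fromBlocks x' 0 0 a' =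
        Matrix.fromBlocks (x * x') 0 0 (a * a')) := by
  subst hJ
  refine ⟨fun A B hA hB => ?_, ?_, fun K x x' a a' => by simp [fromBlocks_multiply]⟩
  · rw [mul_mul_conjTranspose_eq_iff_of_mem_unitaryGroup hB]
    constructor
    · intro h
      obtain ⟨p, q, r, s, rfl⟩ : ∃ p q r s, A = fromBlocks p q r s :=
        ⟨_, _, _, _, (fromBlocks_toBlocks A).symm⟩
      obtain ⟨p', q', r', s', rfl⟩ : ∃ p q r s, B = fromBlocks p q r s :=
        ⟨_, _, _, _, (fromBlocks_toBlocks B).symm⟩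
      simp only [fromBlocks_multiply, fromBlocks_inj, Matrix.mul_one, Matrix.one_mul,
        Matrix.mul_zero, Matrix.zero_mul, add_zero] at h
      obtain ⟨rfl, rfl, rfl, -⟩ := h
      obtain rfl := upperRight_eq_zero_of_fromBlocks_mem_unitaryGroup hA
      obtain rfl := lowerLeft_eq_zero_of_fromBlocks_mem_unitaryGroup hB
      rw [fromBlocks_diagonal_mem_unitaryGroup_iff] at hA hB
      exact ⟨p, hA.1, s, hA.2, s', hB.2, rfl, rfl⟩
    · rintro ⟨x, -, a, -, b, -, rfl, rfl⟩
      simp [fromBlocks_multiply]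
  · rintro ⟨x, a, b⟩ ⟨x', a', b'⟩ h
    simp only [Prod.mk.injEq, fromBlocks_inj] at h
    obtain ⟨⟨rfl, -, -, rfl⟩, -, -, -, rfl⟩ := h
    rfl
end

section
/- Let L ≤ M ≤ N be natural numbers, let J be the M×N real matrix fromBlocks 1 0 0 0 with upper-left block the L×L identity, and let H ≤ O(M)×O(N) be the subgroup of all pairs (fromBlocks x 0 0 a, fromBlocks x 0 0 b) with x ∈ O(L), a ∈ O(M−L), b ∈ O(N−L). Then the map (A,B) ↦ A·J·Bᵀ induces a bijection between the quotient (O(M)×O(N))/H and the set O_{MN}^L of M×N real matrices U with U·Uᵀ·U = U and trace(U·Uᵀ) = L; that is, the map is surjective onto O_{MN}^L and two pairs have the same image exactly when they lie in the same left coset of H. -/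
open Matrix

namespace Matrix

variable {l m n q r : Type*} [Fintype l] [Fintype q] [Fintype r]

/-- A matrix with orthonormal columns can be completed to an orthogonal matrix. -/
theorem exists_fromCols_mem_orthogonalGroup [DecidableEq l] [DecidableEq q]
    (W : Matrix (l ⊕ q) l ℝ) (hW : Wᵀ * W = 1) :
    ∃ C : Matrix (l ⊕ q) q ℝ, fromCols W C ∈ orthogonalGroup (l ⊕ q) ℝ := by
  let v : l ⊕ q → EuclideanSpace ℝ (l ⊕ q) :=
    Sum.elim (fun j => WithLp.toLp 2 (fun i => W i j)) 0
  have hv : Orthonormal ℝ ((Set.range Sum.inl).domRestrict v) := by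
    rw [orthonormal_iff_ite]
    rintro ⟨_, i, rfl⟩ ⟨_, j, rfl⟩
    have h := congrFun (congrFun hW j) i
    simp only [mul_apply, transpose_apply, one_apply] at h
    simpa [v, PiLp.inner_apply, Subtype.ext_iff, eq_comm] using h
  obtain ⟨b, hb⟩ := hv.exists_orthonormalBasis_extension_of_card_eq (by simp)
  refine ⟨of fun i j => b (Sum.inr j) i, ?_⟩
  have hcols : fromCols W (of fun i j => b (Sum.inr j) i) = of fun i j => b j i := by
    ext i (j | j)
    · simp [hb (Sum.inl j) ⟨j, rfl⟩, v]
    · simp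
  rw [hcols, mem_orthogonalGroup_iff']
  ext i j
  have h := orthonormal_iff_ite.mp b.orthonormal j i
  simpa [mul_apply, PiLp.inner_apply, one_apply, eq_comm] using h

/-- The range of an idempotent matrix of trace `L` has an orthonormal basis of size `L`. -/
theorem exists_orthonormal_cols_of_isIdempotentElem [Fintype n] [DecidableEq n] {L : ℕ}
    {P : Matrix n n ℝ} (hP : IsIdempotentElem P) (htr : P.trace = L) :
    ∃ W : Matrix n (Fin L) ℝ, Wᵀ * W = 1 ∧ P * W = W := by
  let f : EuclideanSpace ℝ n →ₗ[ℝ] EuclideanSpace ℝ n := toEuclideanLin P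
  have hff (x) : f (f x) = f x := by
    simp [f, toLpLin_apply, mulVec_mulVec, hP.eq]
  have hf : IsIdempotentElem f := LinearMap.ext hff
  have hrank : Module.finrank ℝ (LinearMap.range f) = L := by
    have h := (LinearMap.IsIdempotentElem.isProj_range f hf).trace
    have htrace : LinearMap.trace ℝ _ f = P.trace := by
      simp only [f, toLpLin_eq_toLin]
      exact trace_toLin_eq P _
    rw [htrace, htr] at h
    exact_mod_cast h.symm
  let b := (stdOrthonormalBasis ℝ (LinearMap.range f)).reindex (finCongr hrank)
  refine ⟨of fun i j => (b j : EuclideanSpace ℝ n) i, ?_, ?_⟩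
  · ext i j
    have h := orthonormal_iff_ite.mp b.orthonormal j i
    simpa [mul_apply, PiLp.inner_apply, one_apply, eq_comm] using h
  · ext i j
    have h : f (b j) = b j := by
      obtain ⟨x, hx⟩ := (b j).2
      rw [← hx, hff]
    simpa [f, toLpLin_apply, mulVec, dotProduct, mul_apply] using
      congrArg (fun x : EuclideanSpace ℝ n => x i) h

/-- A symmetric idempotent matrix of trace `L` is `W * Wᵀ` for some `W` with `L` orthonormal
columns. -/
theorem exists_mul_transpose_eq_of_isIdempotentElem [Fintype n] {L : ℕ} {P : Matrix n n ℝ}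
    (hP : IsIdempotentElem P) (hsymm : Pᵀ = P) (htr : P.trace = L) :
    ∃ W : Matrix n (Fin L) ℝ, Wᵀ * W = 1 ∧ W * Wᵀ = P := by
  classical
  obtain ⟨W, hW, hPW⟩ := exists_orthonormal_cols_of_isIdempotentElem hP htr
  refine ⟨W, hW, ?_⟩
  have hWP : Wᵀ * P = Wᵀ := by
    rw [← hsymm, ← transpose_mul, hPW]
  have hprod : (P - W * Wᵀ) * (P - W * Wᵀ)ᴴ = P - W * Wᵀ := by
    rw [conjTranspose_eq_transpose_of_trivial, transpose_sub, hsymm, transpose_mul,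
      transpose_transpose, sub_mul, mul_sub, mul_sub, hP.eq, ← Matrix.mul_assoc P, hPW,
      Matrix.mul_assoc W, hWP, Matrix.mul_assoc W, ← Matrix.mul_assoc Wᵀ, hW, Matrix.one_mul]
    abel
  have hzero : P - W * Wᵀ = 0 := by
    rw [← trace_mul_conjTranspose_self_eq_zero_iff, hprod, trace_sub, trace_mul_comm, hW, htr]
    simp
  exact (sub_eq_zero.mp hzero).symm

theorem fromCols_mul_fromBlocks_one_mul_fromCols_transpose [DecidableEq l]
    (W : Matrix m l ℝ) (C : Matrix m q ℝ) (V : Matrix n l ℝ) (D : Matrix n r ℝ) :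
    fromCols W C * (fromBlocks 1 0 0 0 : Matrix (l ⊕ q) (l ⊕ r) ℝ) * (fromCols V D)ᵀ =
      W * Vᵀ := by
  rw [transpose_fromCols, fromCols_mul_fromBlocks, fromCols_mul_fromRows]
  simp

/-- Every partial isometry of rank `L` is obtained from the standard one by orthogonal changes of
bases. -/
theorem exists_eq_mul_fromBlocks_one_mul_transpose [DecidableEq q] [DecidableEq r] {L : ℕ}
    {U : Matrix (Fin L ⊕ q) (Fin L ⊕ r) ℝ} (hU : U * Uᵀ * U = U) (htr : (U * Uᵀ).trace = L) :
    ∃ A ∈ orthogonalGroup (Fin L ⊕ q) ℝ, ∃ B ∈ orthogonalGroup (Fin L ⊕ r) ℝ,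
      U = A * (fromBlocks 1 0 0 0 : Matrix (Fin L ⊕ q) (Fin L ⊕ r) ℝ) * Bᵀ := by
  have hidem : IsIdempotentElem (U * Uᵀ) := by
    rw [IsIdempotentElem, ← Matrix.mul_assoc, hU]
  obtain ⟨W, hW, hWU⟩ := exists_mul_transpose_eq_of_isIdempotentElem hidem (by simp) htr
  have hV : (Uᵀ * W)ᵀ * (Uᵀ * W) = 1 := by
    calc (Uᵀ * W)ᵀ * (Uᵀ * W) = Wᵀ * (U * Uᵀ) * W := by
          simp only [transpose_mul, transpose_transpose, Matrix.mul_assoc]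
      _ = (Wᵀ * W) * (Wᵀ * W) := by simp only [← hWU, Matrix.mul_assoc]
      _ = 1 := by rw [hW, Matrix.one_mul]
  obtain ⟨C, hC⟩ := exists_fromCols_mem_orthogonalGroup W hW
  obtain ⟨D, hD⟩ := exists_fromCols_mem_orthogonalGroup (Uᵀ * W) hV
  refine ⟨_, hC, _, hD, ?_⟩
  rw [fromCols_mul_fromBlocks_one_mul_fromCols_transpose, transpose_mul, transpose_transpose,
    ← Matrix.mul_assoc, hWU, hU]

variable [DecidableEq l] [DecidableEq q] [DecidableEq r]

theorem fromBlocks_mem_orthogonalGroup_iff {x : Matrix l l ℝ} {a : Matrix q q ℝ} :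
    fromBlocks x 0 0 a ∈ orthogonalGroup (l ⊕ q) ℝ ↔
      x ∈ orthogonalGroup l ℝ ∧ a ∈ orthogonalGroup q ℝ := by
  simp only [mem_orthogonalGroup_iff, fromBlocks_transpose, fromBlocks_multiply,
    ← fromBlocks_one, fromBlocks_inj]
  simp

/-- The stabilizer of the standard partial isometry under `(X, Y) ↦ X * J * Yᵀ`. -/
theorem mul_fromBlocks_one_eq_iff {X : Matrix (l ⊕ q) (l ⊕ q) ℝ} {Y : Matrix (l ⊕ r) (l ⊕ r) ℝ}
    (hX : X ∈ orthogonalGroup (l ⊕ q) ℝ) (hY : Y ∈ orthogonalGroup (l ⊕ r) ℝ) :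
    X * (fromBlocks 1 0 0 0 : Matrix (l ⊕ q) (l ⊕ r) ℝ) =
        (fromBlocks 1 0 0 0 : Matrix (l ⊕ q) (l ⊕ r) ℝ) * Y ↔
      ∃ x ∈ orthogonalGroup l ℝ, ∃ a ∈ orthogonalGroup q ℝ, ∃ b ∈ orthogonalGroup r ℝ,
        X = fromBlocks x 0 0 a ∧ Y = fromBlocks x 0 0 b := by
  constructor
  · intro h
    obtain ⟨x, c, d, a, rfl⟩ : ∃ x c d a, X = fromBlocks x c d a :=
      ⟨_, _, _, _, (fromBlocks_toBlocks X).symm⟩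
    obtain ⟨y, e, f, b, rfl⟩ : ∃ y e f b, Y = fromBlocks y e f b :=
      ⟨_, _, _, _, (fromBlocks_toBlocks Y).symm⟩
    simp only [fromBlocks_multiply, fromBlocks_inj, Matrix.mul_one, Matrix.one_mul,
      Matrix.mul_zero, Matrix.zero_mul, add_zero] at h
    obtain ⟨rfl, rfl, rfl, -⟩ := h
    have hXt := (mem_orthogonalGroup_iff' _ _).mp hX
    have hYt := (mem_orthogonalGroup_iff _ _).mp hY
    simp only [fromBlocks_transpose, fromBlocks_multiply, ← fromBlocks_one, fromBlocks_inj,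
      transpose_zero, Matrix.zero_mul, Matrix.mul_zero, add_zero] at hXt hYt
    have hxt : x * xᵀ = 1 := hYt.1
    have hc : c = 0 := by
      rw [← Matrix.one_mul c, ← hxt, Matrix.mul_assoc, hXt.2.1, Matrix.mul_zero]
    have hf : f = 0 := by
      rw [← Matrix.mul_one f, ← hXt.1, ← Matrix.mul_assoc, hYt.2.2.1, Matrix.zero_mul]
    subst hc hf
    rw [fromBlocks_mem_orthogonalGroup_iff] at hX hY
    exact ⟨x, hX.1, a, hX.2, b, hY.2, rfl, rfl⟩
  · rintro ⟨x, -, a, -, b, -, rfl, rfl⟩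
    simp [fromBlocks_multiply]

end Matrix

/-- The map `(A,B) ↦ A * J * Bᵀ`, with `J = fromBlocks 1 0 0 0` (upper-left block
the L×L identity), induces a bijection `(O(M) × O(N))/H ≃ O_{MN}^L`, where `H` is the subgroup
of pairs `(fromBlocks x 0 0 a, fromBlocks x 0 0 b)` with `x ∈ O(L)`, `a ∈ O(M-L)`,
`b ∈ O(N-L)`: the map lands in `O_{MN}^L`, is surjective onto `O_{MN}^L`, and two pairs have
the same image exactly when they lie in the same left coset of `H`. -/
theorem stmt_6 (L M N : ℕ) (hLM : L ≤ M) (hMN : M ≤ N)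
    (J : Matrix (Fin L ⊕ Fin (M - L)) (Fin L ⊕ Fin (N - L)) ℝ)
    (hJ : J = Matrix.fromBlocks 1 0 0 0) :
    (∀ A ∈ Matrix.orthogonalGroup (Fin L ⊕ Fin (M - L)) ℝ,
     ∀ B ∈ Matrix.orthogonalGroup (Fin L ⊕ Fin (N - L)) ℝ,
      (A * J * Bᵀ) * (A * J * Bᵀ)ᵀ * (A * J * Bᵀ) = A * J * Bᵀ ∧
      ((A * J * Bᵀ) * (A * J * Bᵀ)ᵀ).trace = (L : ℝ)) ∧
    (∀ U : Matrix (Fin L ⊕ Fin (M - L)) (Fin L ⊕ Fin (N - L)) ℝ,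
      U * Uᵀ * U = U → (U * Uᵀ).trace = (L : ℝ) →
      ∃ A ∈ Matrix.orthogonalGroup (Fin L ⊕ Fin (M - L)) ℝ,
      ∃ B ∈ Matrix.orthogonalGroup (Fin L ⊕ Fin (N - L)) ℝ, U = A * J * Bᵀ) ∧
    (∀ A ∈ Matrix.orthogonalGroup (Fin L ⊕ Fin (M - L)) ℝ,
     ∀ A' ∈ Matrix.orthogonalGroup (Fin L ⊕ Fin (M - L)) ℝ,
     ∀ B ∈ Matrix.orthogonalGroup (Fin L ⊕ Fin (N - L)) ℝ,
     ∀ B' ∈ Matrix.orthogonalGroup (Fin L ⊕ Fin (N - L)) ℝ,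
      (A * J * Bᵀ = A' * J * B'ᵀ ↔
        ∃ x ∈ Matrix.orthogonalGroup (Fin L) ℝ,
        ∃ a ∈ Matrix.orthogonalGroup (Fin (M - L)) ℝ,
        ∃ b ∈ Matrix.orthogonalGroup (Fin (N - L)) ℝ,
          A' = A * Matrix.fromBlocks x 0 0 a ∧ B' = B * Matrix.fromBlocks x 0 0 b)) := by
  subst hJ
  refine ⟨fun A hA B hB => ?_, fun U hU htr => exists_eq_mul_fromBlocks_one_mul_transpose hU htr,
    fun A hA A' hA' B hB B' hB' => ?_⟩
  · rw [mem_orthogonalGroup_iff'] at hA hB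
    set J : Matrix (Fin L ⊕ Fin (M - L)) (Fin L ⊕ Fin (N - L)) ℝ := fromBlocks 1 0 0 0 with hJ
    have hmul : (A * J * Bᵀ) * (A * J * Bᵀ)ᵀ = A * (J * Jᵀ) * Aᵀ := by
      calc (A * J * Bᵀ) * (A * J * Bᵀ)ᵀ = A * J * (Bᵀ * B) * Jᵀ * Aᵀ := by
            simp only [transpose_mul, transpose_transpose, Matrix.mul_assoc]
        _ = A * (J * Jᵀ) * Aᵀ := by rw [hB, Matrix.mul_one, Matrix.mul_assoc A]
    have hJJJ : J * Jᵀ * J = J := by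
      simp [hJ, fromBlocks_transpose, fromBlocks_multiply]
    rw [hmul]
    constructor
    · calc A * (J * Jᵀ) * Aᵀ * (A * J * Bᵀ) = A * (J * Jᵀ) * (Aᵀ * A) * J * Bᵀ := by
            simp only [Matrix.mul_assoc]
        _ = A * (J * Jᵀ * J) * Bᵀ := by rw [hA, Matrix.mul_one, Matrix.mul_assoc A]
        _ = A * J * Bᵀ := by rw [hJJJ]
    · rw [trace_mul_comm, ← Matrix.mul_assoc, hA, Matrix.one_mul]
      simp [hJ, fromBlocks_transpose, fromBlocks_multiply, trace, Fintype.sum_sum_type]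
  · have hX : Aᵀ * A' ∈ orthogonalGroup (Fin L ⊕ Fin (M - L)) ℝ :=
      mul_mem (Unitary.star_mem hA) hA'
    have hY : Bᵀ * B' ∈ orthogonalGroup (Fin L ⊕ Fin (N - L)) ℝ :=
      mul_mem (Unitary.star_mem hB) hB'
    have hA₁ := (mem_orthogonalGroup_iff _ _).mp hA
    have hA₂ := (mem_orthogonalGroup_iff' _ _).mp hA
    have hB₁ := (mem_orthogonalGroup_iff _ _).mp hB
    have hB₂ := (mem_orthogonalGroup_iff' _ _).mp hB
    have hB'₂ := (mem_orthogonalGroup_iff' _ _).mp hB'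
    have hB'₁ := (mem_orthogonalGroup_iff _ _).mp hB'
    have hA_iff (Z) : Aᵀ * A' = Z ↔ A' = A * Z := by
      constructor
      · rintro rfl
        rw [← Matrix.mul_assoc, hA₁, Matrix.one_mul]
      · rintro rfl
        rw [← Matrix.mul_assoc, hA₂, Matrix.one_mul]
    have hB_iff (Z) : Bᵀ * B' = Z ↔ B' = B * Z := by
      constructor
      · rintro rfl
        rw [← Matrix.mul_assoc, hB₁, Matrix.one_mul]
      · rintro rfl
        rw [← Matrix.mul_assoc, hB₂, Matrix.one_mul]
    simp only [← hA_iff, ← hB_iff]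
    rw [← mul_fromBlocks_one_eq_iff hX hY]
    constructor
    · intro h
      have h' := congrArg (fun Z => Aᵀ * Z * B') h
      simp only [Matrix.mul_assoc, hB'₂, Matrix.mul_one] at h'
      rw [← Matrix.mul_assoc Aᵀ A, hA₂, Matrix.one_mul] at h'
      rw [h', Matrix.mul_assoc]
    · intro h
      have h' := congrArg (fun Z => A * Z * B'ᵀ) h
      simp only [Matrix.mul_assoc, hB'₁, Matrix.mul_one] at h'
      rw [← Matrix.mul_assoc A Aᵀ, hA₁, Matrix.one_mul] at h'
      rw [Matrix.mul_assoc, Matrix.mul_assoc, h']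
end

section
/- Let L ≤ M ≤ N be natural numbers, let J be the M×N complex matrix fromBlocks 1 0 0 0 with upper-left block the L×L identity, and let H ≤ U(M)×U(N) be the subgroup of all pairs (fromBlocks x 0 0 a, fromBlocks x 0 0 b) with x ∈ U(L), a ∈ U(M−L), b ∈ U(N−L). Then the map (A,B) ↦ A·J·Bᴴ induces a bijection between the quotient (U(M)×U(N))/H and the set U_{MN}^L of M×N complex matrices U with U·Uᴴ·U = U and trace(U·Uᴴ) = L; that is, the map is surjective onto U_{MN}^L and two pairs have the same image exactly when they lie in the same left coset of H. -/
open Matrix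

/-- An orthogonal projection whose trace is the size of the first block is unitarily equivalent
to the projection onto the coordinates of that block. -/
theorem exists_unitary_conj_fromBlocks_one {l m : Type*} [Fintype l] [Fintype m]
    [DecidableEq l] [DecidableEq m] {P : Matrix (l ⊕ m) (l ⊕ m) ℂ} (hP : P.IsHermitian)
    (hPP : P * P = P) (htr : P.trace = (Fintype.card l : ℂ)) :
    ∃ A ∈ unitaryGroup (l ⊕ m) ℂ, P = A * fromBlocks 1 0 0 0 * Aᴴ := by
  classical
  have hev : ∀ i, hP.eigenvalues i = 0 ∨ hP.eigenvalues i = 1 := fun i => by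
    simpa using IsIdempotentElem.spectrum_subset ℝ hPP (hP.eigenvalues_mem_spectrum_real i)
  have hcard : Fintype.card {i : l ⊕ m // i.isLeft = true} =
      Fintype.card {i // hP.eigenvalues i = 1} := by
    have hsum : ∑ i, hP.eigenvalues i = Fintype.card {i // hP.eigenvalues i = 1} := by
      rw [Fintype.card_subtype, Finset.card_filter, Nat.cast_sum]
      refine Finset.sum_congr rfl fun i _ => ?_
      rcases hev i with h | h <;> simp [h]
    have hl : Fintype.card {i : l ⊕ m // i.isLeft = true} = Fintype.card l := by
      rw [Fintype.card_subtype, Finset.card_filter, Fintype.sum_sum_type]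
      simp
    rw [hP.trace_eq_sum_eigenvalues] at htr
    rw [hl]
    have h : ((∑ i, hP.eigenvalues i : ℝ) : ℂ) = ((Fintype.card l : ℝ) : ℂ) := by
      push_cast
      exact htr
    exact_mod_cast (Complex.ofReal_injective h).symm.trans hsum
  let e := (Fintype.equivOfCardEq hcard).extendSubtype
  have hinl (i : l) : hP.eigenvalues (e (Sum.inl i)) = 1 :=
    (Fintype.equivOfCardEq hcard).extendSubtype_mem (Sum.inl i) rfl
  have hinr (i : m) : hP.eigenvalues (e (Sum.inr i)) = 0 :=
    (hev _).resolve_right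
      ((Fintype.equivOfCardEq hcard).extendSubtype_not_mem (Sum.inr i) (by simp))
  have hD : (diagonal (RCLike.ofReal ∘ hP.eigenvalues) : Matrix (l ⊕ m) (l ⊕ m) ℂ).submatrix e e =
      fromBlocks 1 0 0 0 := by
    rw [submatrix_diagonal_equiv, ← diagonal_one, ← diagonal_zero, fromBlocks_diagonal]
    congr 1
    ext (i | i) <;> simp [hinl, hinr]
  let V : Matrix (l ⊕ m) (l ⊕ m) ℂ := hP.eigenvectorUnitary
  have hV : V * Vᴴ = 1 := Unitary.coe_mul_star_self hP.eigenvectorUnitary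
  refine ⟨V.submatrix id e, mem_unitaryGroup_iff.2 ?_, ?_⟩
  · rw [star_eq_conjTranspose, conjTranspose_submatrix, submatrix_mul_equiv, hV, submatrix_id_id]
  · rw [← hD, conjTranspose_submatrix, submatrix_mul_equiv, submatrix_mul_equiv, submatrix_id_id]
    exact hP.spectral_theorem

open scoped ComplexOrder in
/-- A block upper triangular unitary matrix is block diagonal, with unitary diagonal blocks. -/
theorem fromBlocks_zero₂₁_mem_unitaryGroup {l m : Type*} [Fintype l] [Fintype m]
    [DecidableEq l] [DecidableEq m] {x : Matrix l l ℂ} {y : Matrix l m ℂ} {a : Matrix m m ℂ}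
    (h : fromBlocks x y 0 a ∈ unitaryGroup (l ⊕ m) ℂ) :
    x ∈ unitaryGroup l ℂ ∧ y = 0 ∧ a ∈ unitaryGroup m ℂ := by
  have h₁ := mem_unitaryGroup_iff.1 h
  have h₂ := mem_unitaryGroup_iff'.1 h
  simp only [star_eq_conjTranspose, fromBlocks_conjTranspose, fromBlocks_multiply,
    ← fromBlocks_one, fromBlocks_inj, conjTranspose_zero, Matrix.zero_mul, Matrix.mul_zero,
    add_zero, zero_add] at h₁ h₂
  have hx : x ∈ unitaryGroup l ℂ := mem_unitaryGroup_iff'.2 h₂.1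
  refine ⟨hx, ?_, mem_unitaryGroup_iff.2 h₁.2.2.2⟩
  have hxx : x * xᴴ = 1 := mem_unitaryGroup_iff.1 hx
  have hyy : y * yᴴ = 0 := by simpa [hxx] using h₁.1
  exact self_mul_conjTranspose_eq_zero.1 hyy

/-- A block diagonal matrix with unitary diagonal blocks is unitary. -/
theorem fromBlocks_mem_unitaryGroup {l m : Type*} [Fintype l] [Fintype m]
    [DecidableEq l] [DecidableEq m] {x : Matrix l l ℂ} {a : Matrix m m ℂ}
    (hx : x ∈ unitaryGroup l ℂ) (ha : a ∈ unitaryGroup m ℂ) :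
    fromBlocks x 0 0 a ∈ unitaryGroup (l ⊕ m) ℂ := by
  rw [mem_unitaryGroup_iff, star_eq_conjTranspose] at *
  simp [fromBlocks_conjTranspose, fromBlocks_multiply, hx, ha]

open scoped ComplexOrder in
/-- A partial isometry whose initial and final projections are both the projection onto the first
block is a unitary matrix on that block, extended by zero. -/
theorem exists_unitary_eq_fromBlocks {l m n : Type*} [Fintype l] [Fintype m] [Fintype n]
    [DecidableEq l] {Y : Matrix (l ⊕ m) (l ⊕ n) ℂ}
    (h₁ : Y * Yᴴ = fromBlocks 1 0 0 0) (h₂ : Yᴴ * Y = fromBlocks 1 0 0 0) :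
    ∃ y ∈ unitaryGroup l ℂ, Y = fromBlocks y 0 0 0 := by
  obtain ⟨y, p, q, r, rfl⟩ : ∃ y p q r, Y = fromBlocks y p q r :=
    ⟨_, _, _, _, (fromBlocks_toBlocks Y).symm⟩
  simp only [fromBlocks_conjTranspose, fromBlocks_multiply, fromBlocks_inj] at h₁ h₂
  have hrow : fromCols q r = 0 := by
    rw [← self_mul_conjTranspose_eq_zero, conjTranspose_fromCols_eq_fromRows_conjTranspose,
      fromCols_mul_fromRows, h₁.2.2.2]
  have hcol : fromRows p r = 0 := by
    rw [← conjTranspose_mul_self_eq_zero, conjTranspose_fromRows_eq_fromCols_conjTranspose,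
      fromCols_mul_fromRows, h₂.2.2.2]
  rw [← fromCols_zero, fromCols_ext_iff] at hrow
  rw [← fromRows_zero, fromRows_ext_iff] at hcol
  obtain ⟨rfl, rfl⟩ := hrow
  obtain ⟨rfl, -⟩ := hcol
  exact ⟨y, mem_unitaryGroup_iff.2 (by simpa [star_eq_conjTranspose] using h₁.1), rfl⟩

/-- A partial isometry whose rank is the size of the first block is unitarily equivalent to the
standard one. -/
theorem exists_unitary_mul_fromBlocks_one_mul {l m n : Type*} [Fintype l] [Fintype m] [Fintype n]
    [DecidableEq l] [DecidableEq m] [DecidableEq n] {U : Matrix (l ⊕ m) (l ⊕ n) ℂ}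
    (hU : U * Uᴴ * U = U) (htr : (U * Uᴴ).trace = (Fintype.card l : ℂ)) :
    ∃ A ∈ unitaryGroup (l ⊕ m) ℂ, ∃ B ∈ unitaryGroup (l ⊕ n) ℂ,
      U = A * (fromBlocks 1 0 0 0 : Matrix (l ⊕ m) (l ⊕ n) ℂ) * Bᴴ := by
  obtain ⟨A, hA, hUA⟩ := exists_unitary_conj_fromBlocks_one (isHermitian_mul_conjTranspose_self U)
    (by rw [← Matrix.mul_assoc, hU]) htr
  obtain ⟨B, hB, hUB⟩ := exists_unitary_conj_fromBlocks_one (isHermitian_conjTranspose_mul_self U)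
    (by rw [Matrix.mul_assoc, ← Matrix.mul_assoc U, hU]) (by rwa [trace_mul_comm])
  have hA₁ : A * Aᴴ = 1 := mem_unitaryGroup_iff.1 hA
  have hA₂ : Aᴴ * A = 1 := mem_unitaryGroup_iff'.1 hA
  have hB₁ : B * Bᴴ = 1 := mem_unitaryGroup_iff.1 hB
  have hB₂ : Bᴴ * B = 1 := mem_unitaryGroup_iff'.1 hB
  obtain ⟨y, hy, hY⟩ := exists_unitary_eq_fromBlocks (Y := Aᴴ * U * B)
    (calc
      _ = Aᴴ * (U * (B * Bᴴ) * Uᴴ) * A := by simp [Matrix.mul_assoc]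
      _ = (Aᴴ * A) * fromBlocks 1 0 0 0 * (Aᴴ * A) := by
        rw [hB₁, Matrix.mul_one, hUA]; simp only [Matrix.mul_assoc]
      _ = _ := by rw [hA₂, Matrix.one_mul, Matrix.mul_one])
    (calc
      _ = Bᴴ * (Uᴴ * (A * Aᴴ) * U) * B := by simp [Matrix.mul_assoc]
      _ = (Bᴴ * B) * fromBlocks 1 0 0 0 * (Bᴴ * B) := by
        rw [hA₁, Matrix.mul_one, hUB]; simp only [Matrix.mul_assoc]
      _ = _ := by rw [hB₂, Matrix.one_mul, Matrix.mul_one])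
  refine ⟨A * fromBlocks y 0 0 1, mul_mem hA (fromBlocks_mem_unitaryGroup hy (one_mem _)),
    B, hB, ?_⟩
  calc
    U = (A * Aᴴ) * U * (B * Bᴴ) := by rw [hA₁, hB₁, Matrix.one_mul, Matrix.mul_one]
    _ = A * (Aᴴ * U * B) * Bᴴ := by simp only [Matrix.mul_assoc]
    _ = _ := by rw [hY, Matrix.mul_assoc A (fromBlocks y 0 0 1), fromBlocks_multiply]; simp

/-- The stabilizer of the standard partial isometry `fromBlocks 1 0 0 0` under the action of pairs
of unitary matrices. -/
theorem fromBlocks_one_mul_eq_mul_iff {l m n : Type*} [Fintype l] [Fintype m] [Fintype n]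
    [DecidableEq l] [DecidableEq m] [DecidableEq n]
    {P : Matrix (l ⊕ m) (l ⊕ m) ℂ} {Q : Matrix (l ⊕ n) (l ⊕ n) ℂ}
    (hP : P ∈ unitaryGroup (l ⊕ m) ℂ) (hQ : Q ∈ unitaryGroup (l ⊕ n) ℂ) :
    (fromBlocks 1 0 0 0 : Matrix (l ⊕ m) (l ⊕ n) ℂ) * Q =
        P * (fromBlocks 1 0 0 0 : Matrix (l ⊕ m) (l ⊕ n) ℂ) ↔
      ∃ x ∈ unitaryGroup l ℂ, ∃ a ∈ unitaryGroup m ℂ, ∃ b ∈ unitaryGroup n ℂ,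
        P = fromBlocks x 0 0 a ∧ Q = fromBlocks x 0 0 b := by
  constructor
  · intro h
    obtain ⟨x, p, p', a, rfl⟩ : ∃ x p p' a, P = fromBlocks x p p' a :=
      ⟨_, _, _, _, (fromBlocks_toBlocks P).symm⟩
    obtain ⟨x', q, q', b, rfl⟩ : ∃ x q q' b, Q = fromBlocks x q q' b :=
      ⟨_, _, _, _, (fromBlocks_toBlocks Q).symm⟩
    simp only [fromBlocks_multiply, fromBlocks_inj, Matrix.one_mul, Matrix.mul_one,
      Matrix.zero_mul, Matrix.mul_zero, add_zero] at h
    obtain ⟨rfl, rfl, h', -⟩ := h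
    subst h'
    obtain ⟨hx, rfl, ha⟩ := fromBlocks_zero₂₁_mem_unitaryGroup hP
    have hQ' := Unitary.star_mem hQ
    rw [star_eq_conjTranspose, fromBlocks_conjTranspose, conjTranspose_zero] at hQ'
    obtain ⟨-, hq, hb⟩ := fromBlocks_zero₂₁_mem_unitaryGroup hQ'
    rw [conjTranspose_eq_zero] at hq
    subst hq
    exact ⟨_, hx, a, ha, b, by simpa [star_eq_conjTranspose] using Unitary.star_mem hb, rfl, rfl⟩
  · rintro ⟨x, -, a, -, b, -, rfl, rfl⟩
    simp [fromBlocks_multiply]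

/-- STATEMENT 6: The map `(A,B) ↦ A * J * Bᴴ`, with `J = fromBlocks 1 0 0 0` (upper-left block
the L×L identity), induces a bijection `(U(M) × U(N))/H ≃ U_{MN}^L`, where `H` is the subgroup
of pairs `(fromBlocks x 0 0 a, fromBlocks x 0 0 b)` with `x ∈ U(L)`, `a ∈ U(M-L)`,
`b ∈ U(N-L)`: the map lands in `U_{MN}^L`, is surjective onto `U_{MN}^L`, and two pairs have
the same image exactly when they lie in the same left coset of `H`. -/
theorem stmt_7 (L M N : ℕ) (hLM : L ≤ M) (hMN : M ≤ N)
    (J : Matrix (Fin L ⊕ Fin (M - L)) (Fin L ⊕ Fin (N - L)) ℂ)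
    (hJ : J = Matrix.fromBlocks 1 0 0 0) :
    (∀ A ∈ Matrix.unitaryGroup (Fin L ⊕ Fin (M - L)) ℂ,
     ∀ B ∈ Matrix.unitaryGroup (Fin L ⊕ Fin (N - L)) ℂ,
      (A * J * Bᴴ) * (A * J * Bᴴ)ᴴ * (A * J * Bᴴ) = A * J * Bᴴ ∧
      ((A * J * Bᴴ) * (A * J * Bᴴ)ᴴ).trace = (L : ℂ)) ∧
    (∀ U : Matrix (Fin L ⊕ Fin (M - L)) (Fin L ⊕ Fin (N - L)) ℂ,
      U * Uᴴ * U = U → (U * Uᴴ).trace = (L : ℂ) →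
      ∃ A ∈ Matrix.unitaryGroup (Fin L ⊕ Fin (M - L)) ℂ,
      ∃ B ∈ Matrix.unitaryGroup (Fin L ⊕ Fin (N - L)) ℂ, U = A * J * Bᴴ) ∧
    (∀ A ∈ Matrix.unitaryGroup (Fin L ⊕ Fin (M - L)) ℂ,
     ∀ A' ∈ Matrix.unitaryGroup (Fin L ⊕ Fin (M - L)) ℂ,
     ∀ B ∈ Matrix.unitaryGroup (Fin L ⊕ Fin (N - L)) ℂ,
     ∀ B' ∈ Matrix.unitaryGroup (Fin L ⊕ Fin (N - L)) ℂ,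
      (A * J * Bᴴ = A' * J * B'ᴴ ↔
        ∃ x ∈ Matrix.unitaryGroup (Fin L) ℂ,
        ∃ a ∈ Matrix.unitaryGroup (Fin (M - L)) ℂ,
        ∃ b ∈ Matrix.unitaryGroup (Fin (N - L)) ℂ,
          A' = A * Matrix.fromBlocks x 0 0 a ∧ B' = B * Matrix.fromBlocks x 0 0 b)) := by
  subst hJ
  refine ⟨fun A hA B hB => ?_, fun U hU htr =>
    exists_unitary_mul_fromBlocks_one_mul hU (by simpa using htr), fun A hA A' hA' B hB B' hB' => ?_⟩
  · have hA₂ : Aᴴ * A = 1 := mem_unitaryGroup_iff'.1 hA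
    have hB₂ : Bᴴ * B = 1 := mem_unitaryGroup_iff'.1 hB
    set J : Matrix (Fin L ⊕ Fin (M - L)) (Fin L ⊕ Fin (N - L)) ℂ := fromBlocks 1 0 0 0 with hJ
    have hJJ : J * Jᴴ = fromBlocks 1 0 0 0 := by
      simp [hJ, fromBlocks_conjTranspose, fromBlocks_multiply]
    have hUU : A * J * Bᴴ * (A * J * Bᴴ)ᴴ = A * fromBlocks 1 0 0 0 * Aᴴ := by
      calc
        _ = A * (J * (Bᴴ * B) * Jᴴ) * Aᴴ := by simp [Matrix.mul_assoc]
        _ = _ := by rw [hB₂, Matrix.mul_one, hJJ]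
    rw [hUU]
    constructor
    · calc
        _ = A * (fromBlocks 1 0 0 0 * (Aᴴ * A) * J) * Bᴴ := by simp only [Matrix.mul_assoc]
        _ = _ := by rw [hA₂, Matrix.mul_one, hJ, fromBlocks_multiply]; simp
    · rw [trace_mul_comm, ← Matrix.mul_assoc, hA₂, Matrix.one_mul]
      simp [trace, Fintype.sum_sum_type]
  · have hA₁ : A * Aᴴ = 1 := mem_unitaryGroup_iff.1 hA
    have hA₂ : Aᴴ * A = 1 := mem_unitaryGroup_iff'.1 hA
    have hB₁ : B * Bᴴ = 1 := mem_unitaryGroup_iff.1 hB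
    have hB₁' : B' * B'ᴴ = 1 := mem_unitaryGroup_iff.1 hB'
    have hB₂ : Bᴴ * B = 1 := mem_unitaryGroup_iff'.1 hB
    have hB₂' : B'ᴴ * B' = 1 := mem_unitaryGroup_iff'.1 hB'
    have hiff : ∀ J : Matrix (Fin L ⊕ Fin (M - L)) (Fin L ⊕ Fin (N - L)) ℂ,
        A * J * Bᴴ = A' * J * B'ᴴ ↔ J * (Bᴴ * B') = Aᴴ * A' * J := by
      refine fun J => ⟨fun h => ?_, fun h => ?_⟩
      · calc
          _ = (Aᴴ * A) * J * (Bᴴ * B') := by rw [hA₂, Matrix.one_mul]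
          _ = Aᴴ * (A * J * Bᴴ) * B' := by simp only [Matrix.mul_assoc]
          _ = Aᴴ * A' * J * (B'ᴴ * B') := by rw [h]; simp only [Matrix.mul_assoc]
          _ = _ := by rw [hB₂', Matrix.mul_one]
      · calc
          _ = A * J * Bᴴ * (B' * B'ᴴ) := by rw [hB₁', Matrix.mul_one]
          _ = A * (J * (Bᴴ * B')) * B'ᴴ := by simp only [Matrix.mul_assoc]
          _ = (A * Aᴴ) * A' * J * B'ᴴ := by rw [h]; simp only [Matrix.mul_assoc]
          _ = _ := by rw [hA₁, Matrix.one_mul]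
    have hAF (F : Matrix (Fin L ⊕ Fin (M - L)) (Fin L ⊕ Fin (M - L)) ℂ) :
        Aᴴ * A' = F ↔ A' = A * F := by
      constructor
      · rintro rfl
        rw [← Matrix.mul_assoc, hA₁, Matrix.one_mul]
      · rintro rfl
        rw [← Matrix.mul_assoc, hA₂, Matrix.one_mul]
    have hBG (G : Matrix (Fin L ⊕ Fin (N - L)) (Fin L ⊕ Fin (N - L)) ℂ) :
        Bᴴ * B' = G ↔ B' = B * G := by
      constructor
      · rintro rfl
        rw [← Matrix.mul_assoc, hB₁, Matrix.one_mul]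
      · rintro rfl
        rw [← Matrix.mul_assoc, hB₂, Matrix.one_mul]
    have hP : Aᴴ * A' ∈ unitaryGroup _ ℂ := mul_mem (Unitary.star_mem hA) hA'
    have hQ : Bᴴ * B' ∈ unitaryGroup _ ℂ := mul_mem (Unitary.star_mem hB) hB'
    rw [hiff, fromBlocks_one_mul_eq_mul_iff hP hQ]
    simp only [hAF, hBG]
end

section
/- Fix natural numbers s ≥ 1 and L ≤ M ≤ N. Let H_{MN}^{sL} be the set of M×N complex matrices U such that every row and every column of U contains at most one nonzero entry, every nonzero entry z of U satisfies z^s = 1, and U has exactly L nonzero entries. Then: (i) for every U ∈ H_{MN}^{sL}, A ∈ H_M^s and B ∈ H_N^s, the matrix A·U·Bᴴ again lies in H_{MN}^{sL}; and (ii) for any U, V ∈ H_{MN}^{sL} there exist A ∈ H_M^s and B ∈ H_N^s with V = A·U·Bᴴ. That is, the action (A,B)·U = A·U·Bᴴ of H_M^s × H_N^s on H_{MN}^{sL} is well defined and transitive. -/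
open Matrix

/-- Membership in the complex reflection group `H_N^s = ℤ_s ≀ S_N`: a matrix whose entries are
`A i j = w j` when `i = σ j` and `0` otherwise, for a permutation `σ` and s-th roots of unity
`w j`. -/
def IsSignedPermMatrix (s : ℕ) {ι : Type*} [DecidableEq ι] (A : Matrix ι ι ℂ) : Prop :=
  ∃ (σ : Equiv.Perm ι) (w : ι → ℂ), (∀ j, w j ^ s = 1) ∧
    ∀ i j, A i j = if i = σ j then w j else 0

/-- Membership in `H_{MN}^{sL}`: every row and every column has at most one nonzero entry,
every nonzero entry is an s-th root of unity, and there are exactly `L` nonzero entries. -/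
def IsSignedPartialPermMatrix (s L : ℕ) {ι κ : Type*} (U : Matrix ι κ ℂ) : Prop :=
  (∀ i j j', U i j ≠ 0 → U i j' ≠ 0 → j = j') ∧
  (∀ i i' j, U i j ≠ 0 → U i' j ≠ 0 → i = i') ∧
  (∀ i j, U i j ≠ 0 → U i j ^ s = 1) ∧
  Nat.card {p : ι × κ // U p.1 p.2 ≠ 0} = L

theorem mul_mul_conjTranspose_apply_of_signed {ι κ : Type*} [Fintype ι] [DecidableEq ι] [Fintype κ]
    [DecidableEq κ] {A : Matrix ι ι ℂ} {B : Matrix κ κ ℂ} {σ : Equiv.Perm ι} {τ : Equiv.Perm κ}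
    {w : ι → ℂ} {v : κ → ℂ} (hA : ∀ i j, A i j = if i = σ j then w j else 0)
    (hB : ∀ i j, B i j = if i = τ j then v j else 0) (U : Matrix ι κ ℂ) (i : ι) (j : κ) :
    (A * U * Bᴴ) (σ i) (τ j) = w i * U i j * star (v j) := by
  simp [Matrix.mul_apply, hA, hB, apply_ite (starRingEnd ℂ)]

theorem IsSignedPartialPermMatrix.mul_mul_conjTranspose {ι κ : Type*} [Fintype ι] [DecidableEq ι]
    [Fintype κ] [DecidableEq κ] {s L : ℕ} (hs : s ≠ 0) {U : Matrix ι κ ℂ} {A : Matrix ι ι ℂ}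
    {B : Matrix κ κ ℂ} (hU : IsSignedPartialPermMatrix s L U) (hA : IsSignedPermMatrix s A)
    (hB : IsSignedPermMatrix s B) : IsSignedPartialPermMatrix s L (A * U * Bᴴ) := by
  obtain ⟨σ, w, hw, hA⟩ := hA
  obtain ⟨τ, v, hv, hB⟩ := hB
  obtain ⟨hrow, hcol, hroot, hcard⟩ := hU
  have key := mul_mul_conjTranspose_apply_of_signed hA hB U
  have ne_zero {z : ℂ} (hz : z ^ s = 1) : z ≠ 0 := by
    rintro rfl
    simp [hs] at hz
  have key_ne (i j) : (A * U * Bᴴ) (σ i) (τ j) ≠ 0 ↔ U i j ≠ 0 := by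
    simp [key, ne_zero (hw i), ne_zero (hv j)]
  refine ⟨?_, ?_, ?_, ?_⟩
  · intro i j j' h h'
    obtain ⟨i, rfl⟩ := σ.surjective i
    obtain ⟨j, rfl⟩ := τ.surjective j
    obtain ⟨j', rfl⟩ := τ.surjective j'
    rw [key_ne] at h h'
    rw [hrow i j j' h h']
  · intro i i' j h h'
    obtain ⟨i, rfl⟩ := σ.surjective i
    obtain ⟨i', rfl⟩ := σ.surjective i'
    obtain ⟨j, rfl⟩ := τ.surjective j
    rw [key_ne] at h h'
    rw [hcol i i' j h h']
  · intro i j h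
    obtain ⟨i, rfl⟩ := σ.surjective i
    obtain ⟨j, rfl⟩ := τ.surjective j
    rw [key_ne] at h
    rw [key, mul_pow, mul_pow, hw, hroot i j h, ← star_pow, hv]
    simp
  · rw [← hcard]
    exact (Nat.card_congr ((σ.prodCongr τ).subtypeEquiv fun p => (key_ne p.1 p.2).symm)).symm

theorem exists_perm_comp_eq_of_injective {α β : Type*} [Finite β] {f g : α → β}
    (hf : Function.Injective f) (hg : Function.Injective g) :
    ∃ σ : Equiv.Perm β, ∀ a, σ (f a) = g a := by
  classical
  let e : {b // b ∈ Set.range f} ≃ {b // b ∈ Set.range g} :=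
    (Equiv.ofInjective f hf).symm.trans (Equiv.ofInjective g hg)
  refine ⟨e.extendSubtype, fun a => ?_⟩
  rw [e.extendSubtype_apply_of_mem (f a) ⟨a, rfl⟩]
  simp [e]

theorem IsSignedPartialPermMatrix.injective_fst {ι κ : Type*} {s L : ℕ} {U : Matrix ι κ ℂ}
    (hU : IsSignedPartialPermMatrix s L U) :
    Function.Injective fun p : {p : ι × κ // U p.1 p.2 ≠ 0} => p.1.1 := by
  rintro ⟨⟨i, j⟩, h⟩ ⟨⟨i', j'⟩, h'⟩ (rfl : i = i')
  simp [hU.1 i j j' h h']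

theorem IsSignedPartialPermMatrix.injective_snd {ι κ : Type*} {s L : ℕ} {U : Matrix ι κ ℂ}
    (hU : IsSignedPartialPermMatrix s L U) :
    Function.Injective fun p : {p : ι × κ // U p.1 p.2 ≠ 0} => p.1.2 := by
  rintro ⟨⟨i, j⟩, h⟩ ⟨⟨i', j'⟩, h'⟩ (rfl : j = j')
  simp [hU.2.1 i i' j h h']

/-- Any two matrices in `H_{MN}^{sL}` have supports related by a permutation of the rows and a
permutation of the columns. -/
theorem IsSignedPartialPermMatrix.exists_perm_support {ι κ : Type*} [Finite ι] [Finite κ]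
    {s L : ℕ} {U V : Matrix ι κ ℂ} (hU : IsSignedPartialPermMatrix s L U)
    (hV : IsSignedPartialPermMatrix s L V) :
    ∃ (σ : Equiv.Perm ι) (τ : Equiv.Perm κ), ∀ i j, V (σ i) (τ j) ≠ 0 ↔ U i j ≠ 0 := by
  obtain ⟨e⟩ := Finite.card_eq.1 (hU.2.2.2.trans hV.2.2.2.symm)
  obtain ⟨σ, hσ⟩ := exists_perm_comp_eq_of_injective hU.injective_fst
    (hV.injective_fst.comp e.injective)
  obtain ⟨τ, hτ⟩ := exists_perm_comp_eq_of_injective hU.injective_snd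
    (hV.injective_snd.comp e.injective)
  refine ⟨σ, τ, fun i j => ⟨fun h => ?_, fun h => ?_⟩⟩
  · obtain ⟨p, hp⟩ := e.surjective ⟨(σ i, τ j), h⟩
    have hi : p.1.1 = i := σ.injective (by simp [hσ p, hp])
    have hj : p.1.2 = j := τ.injective (by simp [hτ p, hp])
    exact hi ▸ hj ▸ p.2
  · have hi : σ i = (e ⟨(i, j), h⟩).1.1 := hσ ⟨(i, j), h⟩
    have hj : τ j = (e ⟨(i, j), h⟩).1.2 := hτ ⟨(i, j), h⟩
    rw [hi, hj]
    exact (e ⟨(i, j), h⟩).2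

theorem IsSignedPartialPermMatrix.exists_eq_mul_mul_conjTranspose {ι κ : Type*} [Fintype ι]
    [DecidableEq ι] [Fintype κ] [DecidableEq κ] {s L : ℕ} {U V : Matrix ι κ ℂ}
    (hU : IsSignedPartialPermMatrix s L U) (hV : IsSignedPartialPermMatrix s L V) :
    ∃ (A : Matrix ι ι ℂ) (B : Matrix κ κ ℂ),
      IsSignedPermMatrix s A ∧ IsSignedPermMatrix s B ∧ V = A * U * Bᴴ := by
  obtain ⟨σ, τ, hsupp⟩ := hU.exists_perm_support hV
  have hweight (i : ι) : ∃ w : ℂ, w ^ s = 1 ∧ ∀ j, U i j ≠ 0 → V (σ i) (τ j) = w * U i j := by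
    by_cases h : ∃ j, U i j ≠ 0
    · obtain ⟨j, hj⟩ := h
      refine ⟨V (σ i) (τ j) / U i j, ?_, fun j' hj' => ?_⟩
      · rw [div_pow, hU.2.2.1 i j hj, hV.2.2.1 _ _ ((hsupp i j).2 hj), div_one]
      · rw [← hU.1 i j j' hj hj', div_mul_cancel₀ _ hj]
    · exact ⟨1, one_pow s, fun j hj => absurd ⟨j, hj⟩ h⟩
  choose w hw hVU using hweight
  let A : Matrix ι ι ℂ := .of fun i j => if i = σ j then w j else 0
  let B : Matrix κ κ ℂ := .of fun i j => if i = τ j then 1 else 0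
  have hA (i j) : A i j = if i = σ j then w j else 0 := rfl
  have hB (i j) : B i j = if i = τ j then 1 else 0 := rfl
  refine ⟨A, B, ⟨σ, w, hw, hA⟩, ⟨τ, fun _ => 1, fun _ => one_pow s, hB⟩, ?_⟩
  ext i j
  obtain ⟨i, rfl⟩ := σ.surjective i
  obtain ⟨j, rfl⟩ := τ.surjective j
  rw [mul_mul_conjTranspose_apply_of_signed hA hB, star_one, mul_one]
  by_cases h : U i j = 0
  · rw [h, mul_zero]
    exact not_not.1 fun hne => (hsupp i j).1 hne h
  · exact hVU i j h

/-- The action `(A,B)·U = A * U * Bᴴ` of `H_M^s × H_N^s` on `H_{MN}^{sL}` is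
well defined (i) and transitive (ii). -/
theorem stmt_11 (s L M N : ℕ) (hs : 1 ≤ s) (hLM : L ≤ M) (hMN : M ≤ N) :
    (∀ (U : Matrix (Fin M) (Fin N) ℂ) (A : Matrix (Fin M) (Fin M) ℂ)
        (B : Matrix (Fin N) (Fin N) ℂ),
      IsSignedPartialPermMatrix s L U → IsSignedPermMatrix s A → IsSignedPermMatrix s B →
      IsSignedPartialPermMatrix s L (A * U * Bᴴ)) ∧
    (∀ U V : Matrix (Fin M) (Fin N) ℂ,
      IsSignedPartialPermMatrix s L U → IsSignedPartialPermMatrix s L V →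
      ∃ (A : Matrix (Fin M) (Fin M) ℂ) (B : Matrix (Fin N) (Fin N) ℂ),
        IsSignedPermMatrix s A ∧ IsSignedPermMatrix s B ∧ V = A * U * Bᴴ) := by
  exact ⟨fun _ _ _ hU hA hB => hU.mul_mul_conjTranspose (Nat.one_le_iff_ne_zero.1 hs) hA hB,
    fun _ _ hU hV => hU.exists_eq_mul_mul_conjTranspose hV⟩
end

section
/- Fix natural numbers s ≥ 1 and L ≤ M ≤ N, and let J be the M×N complex matrix fromBlocks 1 0 0 0 with upper-left block the L×L identity. For A ∈ H_M^s and B ∈ H_N^s, one has A·J·Bᴴ = J if and only if there exist x ∈ H_L^s, a ∈ H_{M−L}^s, b ∈ H_{N−L}^s such that A = fromBlocks x 0 0 a and B = fromBlocks x 0 0 b. Consequently, the stabilizer of J under the action (A,B)·U = A·U·Bᴴ of H_M^s × H_N^s is isomorphic to H_L^s × H_{M−L}^s × H_{N−L}^s, and the set H_{MN}^{sL} of signed partial permutation matrices is in bijection with the quotient (H_M^s × H_N^s)/(H_L^s × H_{M−L}^s × H_{N−L}^s). -/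
open Matrix

/-- The monomial matrix with permutation `σ` and weights `w`. -/
def monomialMatrix {ι : Type*} [DecidableEq ι] (σ : Equiv.Perm ι) (w : ι → ℂ) : Matrix ι ι ℂ :=
  fun i j => if i = σ j then w j else 0

theorem monomialMatrix_apply {ι : Type*} [DecidableEq ι] (σ : Equiv.Perm ι) (w : ι → ℂ) (i j : ι) :
    monomialMatrix σ w i j = if i = σ j then w j else 0 := rfl

theorem isSignedPermMatrix_iff {s : ℕ} {ι : Type*} [DecidableEq ι] {A : Matrix ι ι ℂ} :
    IsSignedPermMatrix s A ↔ ∃ σ w, (∀ j, w j ^ s = 1) ∧ A = monomialMatrix σ w := by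
  simp only [IsSignedPermMatrix, ← Matrix.ext_iff, monomialMatrix_apply]

theorem IsSignedPermMatrix.conjTranspose {s : ℕ} {ι : Type*} [DecidableEq ι] {A : Matrix ι ι ℂ}
    (hA : IsSignedPermMatrix s A) : IsSignedPermMatrix s Aᴴ := by
  obtain ⟨σ, w, hw, rfl⟩ := isSignedPermMatrix_iff.1 hA
  refine ⟨σ.symm, fun j => star (w (σ.symm j)), fun j => by rw [← star_pow, hw, star_one],
    fun i j => ?_⟩
  obtain ⟨p, rfl⟩ := σ.surjective j
  simp only [conjTranspose_apply, monomialMatrix_apply, Equiv.symm_apply_apply]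
  by_cases h : i = p <;> simp [h, eq_comm]

section

variable {ι κ : Type*} [Fintype ι] [DecidableEq ι]

theorem monomialMatrix_mul_apply (σ : Equiv.Perm ι) (w : ι → ℂ) (X : Matrix ι κ ℂ) (p : ι) (q : κ) :
    (monomialMatrix σ w * X) (σ p) q = w p * X p q := by
  simp [Matrix.mul_apply, monomialMatrix_apply]

theorem monomialMatrix_mul_conjTranspose_apply [Fintype κ] [DecidableEq κ] (σ : Equiv.Perm ι)
    (τ : Equiv.Perm κ) (w : ι → ℂ) (v : κ → ℂ) (X : Matrix ι κ ℂ) (p : ι) (q : κ) :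
    (monomialMatrix σ w * X * (monomialMatrix τ v)ᴴ) (σ p) (τ q) = w p * X p q * star (v q) := by
  rw [Matrix.mul_apply, Finset.sum_eq_single q]
  · simp [monomialMatrix_mul_apply, monomialMatrix_apply]
  · intro r _ hr
    simp [monomialMatrix_apply, hr.symm]
  · simp

theorem Complex.mul_star_self_of_pow_eq_one {s : ℕ} (hs : s ≠ 0) {z : ℂ} (hz : z ^ s = 1) :
    z * star z = 1 := by
  simp [Complex.mul_conj', Complex.norm_eq_one_of_pow_eq_one hz hs]

theorem IsSignedPermMatrix.mul {s : ℕ} {A B : Matrix ι ι ℂ} (hA : IsSignedPermMatrix s A)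
    (hB : IsSignedPermMatrix s B) : IsSignedPermMatrix s (A * B) := by
  obtain ⟨σ, w, hw, rfl⟩ := isSignedPermMatrix_iff.1 hA
  obtain ⟨τ, v, hv, rfl⟩ := isSignedPermMatrix_iff.1 hB
  refine ⟨τ.trans σ, fun j => w (τ j) * v j, fun j => by simp [mul_pow, hw, hv], fun i j => ?_⟩
  obtain ⟨p, rfl⟩ := σ.surjective i
  simp only [monomialMatrix_mul_apply, monomialMatrix_apply, Equiv.trans_apply,
    EmbeddingLike.apply_eq_iff_eq]
  by_cases h : p = τ j <;> simp [h]

theorem IsSignedPermMatrix.mul_conjTranspose_self {s : ℕ} (hs : s ≠ 0) {A : Matrix ι ι ℂ}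
    (hA : IsSignedPermMatrix s A) : A * Aᴴ = 1 := by
  obtain ⟨σ, w, hw, rfl⟩ := isSignedPermMatrix_iff.1 hA
  ext i j
  obtain ⟨p, rfl⟩ := σ.surjective i
  obtain ⟨q, rfl⟩ := σ.surjective j
  have := monomialMatrix_mul_conjTranspose_apply σ σ w w 1 p q
  rw [Matrix.mul_one] at this
  rw [this]
  by_cases h : p = q
  · subst h
    simpa using Complex.mul_star_self_of_pow_eq_one hs (hw p)
  · simp [h]

theorem IsSignedPermMatrix.conjTranspose_mul_self {s : ℕ} (hs : s ≠ 0) {A : Matrix ι ι ℂ}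
    (hA : IsSignedPermMatrix s A) : Aᴴ * A = 1 :=
  mul_eq_one_comm.1 (hA.mul_conjTranspose_self hs)

end

/-- The matrix with upper-left block the identity indexed by `l`, and zeros elsewhere. -/
abbrev partialOne (l m n : Type*) [DecidableEq l] : Matrix (l ⊕ m) (l ⊕ n) ℂ :=
  fromBlocks 1 0 0 0

theorem partialOne_ne_zero_iff {l m n : Type*} [DecidableEq l] (p : l ⊕ m) (q : l ⊕ n) :
    partialOne l m n p q ≠ 0 ↔ ∃ k, p = Sum.inl k ∧ q = Sum.inl k := by
  rcases p with p | p <;> rcases q with q | q <;> simp [Matrix.one_apply, eq_comm]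

theorem IsSignedPermMatrix.fromBlocks {s : ℕ} {l m : Type*} [DecidableEq l] [DecidableEq m]
    {x : Matrix l l ℂ} {a : Matrix m m ℂ}
    (hx : IsSignedPermMatrix s x) (ha : IsSignedPermMatrix s a) :
    IsSignedPermMatrix s (fromBlocks x 0 0 a) := by
  obtain ⟨σ, w, hw, rfl⟩ := isSignedPermMatrix_iff.1 hx
  obtain ⟨τ, v, hv, rfl⟩ := isSignedPermMatrix_iff.1 ha
  refine ⟨Equiv.sumCongr σ τ, Sum.elim w v, by simp [hw, hv], ?_⟩
  rintro (i | i) (j | j) <;> simp [monomialMatrix_apply]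

section

variable {l m n : Type*} [Fintype l] [DecidableEq l] [Fintype m] [DecidableEq m]
  [Fintype n] [DecidableEq n]

theorem monomialMatrix_eq_fromBlocks {s : ℕ} {σ : Equiv.Perm (l ⊕ m)} {w : l ⊕ m → ℂ}
    (hw : ∀ j, w j ^ s = 1) (hσ : ∀ k, ∃ k', σ (Sum.inl k) = Sum.inl k') :
    ∃ x a, IsSignedPermMatrix s x ∧ IsSignedPermMatrix s a ∧
      monomialMatrix σ w = fromBlocks x 0 0 a := by
  obtain ⟨⟨σ₁, σ₂⟩, rfl⟩ := Equiv.Perm.mem_sumCongrHom_range_of_perm_mapsTo_inl (σ := σ) (by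
    rintro _ ⟨k, rfl⟩
    obtain ⟨k', h⟩ := hσ k
    exact ⟨k', h.symm⟩)
  refine ⟨monomialMatrix σ₁ (w ∘ Sum.inl), monomialMatrix σ₂ (w ∘ Sum.inr),
    ⟨σ₁, _, fun j => hw _, fun _ _ => rfl⟩, ⟨σ₂, _, fun j => hw _, fun _ _ => rfl⟩, ?_⟩
  ext (i | i) (j | j) <;> simp [monomialMatrix_apply]

theorem mul_partialOne_mul_conjTranspose_eq_self_iff {s : ℕ} (hs : s ≠ 0)
    {A : Matrix (l ⊕ m) (l ⊕ m) ℂ} {B : Matrix (l ⊕ n) (l ⊕ n) ℂ}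
    (hA : IsSignedPermMatrix s A) (hB : IsSignedPermMatrix s B) :
    A * partialOne l m n * Bᴴ = partialOne l m n ↔
      ∃ x a b, IsSignedPermMatrix s x ∧ IsSignedPermMatrix s a ∧ IsSignedPermMatrix s b ∧
        A = fromBlocks x 0 0 a ∧ B = fromBlocks x 0 0 b := by
  constructor
  · intro h
    have hcomm : A * partialOne l m n = partialOne l m n * B := by
      conv_rhs => rw [← h]
      rw [Matrix.mul_assoc, hB.conjTranspose_mul_self hs, Matrix.mul_one]
    obtain ⟨σ, w, hw, rfl⟩ := isSignedPermMatrix_iff.1 hA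
    obtain ⟨τ, v, hv, rfl⟩ := isSignedPermMatrix_iff.1 hB
    have key : ∀ k, ∃ k', σ (Sum.inl k) = Sum.inl k' ∧ τ (Sum.inl k) = Sum.inl k' := by
      intro k
      rw [← partialOne_ne_zero_iff, ← h, monomialMatrix_mul_conjTranspose_apply]
      have hw0 := left_ne_zero_of_mul_eq_one (Complex.mul_star_self_of_pow_eq_one hs (hw (Sum.inl k)))
      have hv0 := right_ne_zero_of_mul_eq_one (Complex.mul_star_self_of_pow_eq_one hs (hv (Sum.inl k)))
      simpa using ⟨hw0, by simpa using hv0⟩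
    obtain ⟨x, a, hx, ha, hxa⟩ := monomialMatrix_eq_fromBlocks hw
      fun k => (key k).imp fun _ => And.left
    obtain ⟨y, b, -, hb, hyb⟩ := monomialMatrix_eq_fromBlocks hv
      fun k => (key k).imp fun _ => And.right
    have hxy : x = y := by
      rw [hxa, hyb, fromBlocks_multiply, fromBlocks_multiply, fromBlocks_inj] at hcomm
      simpa using hcomm.1
    exact ⟨x, a, b, hx, ha, hb, hxa, hxy ▸ hyb⟩
  · rintro ⟨x, a, b, hx, -, -, rfl, rfl⟩
    simp [fromBlocks_conjTranspose, fromBlocks_multiply, hx.mul_conjTranspose_self hs]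

theorem IsSignedPermMatrix.isSignedPartialPermMatrix {s : ℕ} (hs : s ≠ 0)
    {A : Matrix (l ⊕ m) (l ⊕ m) ℂ} {B : Matrix (l ⊕ n) (l ⊕ n) ℂ}
    (hA : IsSignedPermMatrix s A) (hB : IsSignedPermMatrix s B) :
    IsSignedPartialPermMatrix s (Nat.card l)
      (A * partialOne l m n * Bᴴ) := by
  obtain ⟨σ, w, hw, rfl⟩ := isSignedPermMatrix_iff.1 hA
  obtain ⟨τ, v, hv, rfl⟩ := isSignedPermMatrix_iff.1 hB
  have hne : ∀ p q, (monomialMatrix σ w *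
      partialOne l m n * (monomialMatrix τ v)ᴴ)
        (σ p) (τ q) ≠ 0 ↔ ∃ k, p = Sum.inl k ∧ q = Sum.inl k := by
    intro p q
    have hw0 := left_ne_zero_of_mul_eq_one (Complex.mul_star_self_of_pow_eq_one hs (hw p))
    have hv0 := right_ne_zero_of_mul_eq_one (Complex.mul_star_self_of_pow_eq_one hs (hv q))
    rw [monomialMatrix_mul_conjTranspose_apply, ← partialOne_ne_zero_iff,
      mul_ne_zero_iff, mul_ne_zero_iff]
    tauto
  refine ⟨?_, ?_, ?_, ?_⟩
  · intro i j j'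
    obtain ⟨p, rfl⟩ := σ.surjective i
    obtain ⟨q, rfl⟩ := τ.surjective j
    obtain ⟨q', rfl⟩ := τ.surjective j'
    rw [hne, hne]
    grind
  · intro i i' j
    obtain ⟨p, rfl⟩ := σ.surjective i
    obtain ⟨p', rfl⟩ := σ.surjective i'
    obtain ⟨q, rfl⟩ := τ.surjective j
    rw [hne, hne]
    grind
  · intro i j
    obtain ⟨p, rfl⟩ := σ.surjective i
    obtain ⟨q, rfl⟩ := τ.surjective j
    rw [hne, monomialMatrix_mul_conjTranspose_apply]
    rintro ⟨k, rfl, rfl⟩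
    rw [partialOne, fromBlocks_apply₁₁, one_apply_eq, mul_one, mul_pow, ← star_pow, hw, hv,
      star_one, mul_one]
  · refine (Nat.card_congr (Equiv.ofBijective
      (fun k => ⟨(σ (Sum.inl k), τ (Sum.inl k)), (hne _ _).2 ⟨k, rfl, rfl⟩⟩) ⟨?_, ?_⟩)).symm
    · intro k k' h
      simpa using congrArg (fun p => p.1.1) h
    · rintro ⟨⟨i, j⟩, h⟩
      obtain ⟨p, rfl⟩ := σ.surjective i
      obtain ⟨q, rfl⟩ := τ.surjective j
      obtain ⟨k, rfl, rfl⟩ := (hne _ _).1 h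
      exact ⟨k, rfl⟩

theorem IsSignedPartialPermMatrix.exists_eq_mul_mul_conjTranspose_s12 {s : ℕ}
    {U : Matrix (l ⊕ m) (l ⊕ n) ℂ} (hU : IsSignedPartialPermMatrix s (Nat.card l) U) :
    ∃ (A : Matrix (l ⊕ m) (l ⊕ m) ℂ) (B : Matrix (l ⊕ n) (l ⊕ n) ℂ),
      IsSignedPermMatrix s A ∧ IsSignedPermMatrix s B ∧ U = A * partialOne l m n * Bᴴ := by
  obtain ⟨hrow, hcol, hpow, hcard⟩ := hU
  obtain ⟨e⟩ : Nonempty (l ≃ {p : (l ⊕ m) × (l ⊕ n) // U p.1 p.2 ≠ 0}) :=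
    Finite.card_eq.1 hcard.symm
  have hf : Function.Injective fun k => (e k).1.1 := fun k k' h => e.injective <| Subtype.ext <|
    Prod.ext h <| hrow _ _ _ (e k).2 (by simpa only [h] using (e k').2)
  have hg : Function.Injective fun k => (e k).1.2 := fun k k' h => e.injective <| Subtype.ext <|
    Prod.ext (hcol _ _ _ (e k).2 (by simpa only [h] using (e k').2)) h
  obtain ⟨σ, hσ⟩ := Equiv.Perm.exists_extending_pair Sum.inl _ Sum.inl_injective hf
  obtain ⟨τ, hτ⟩ := Equiv.Perm.exists_extending_pair Sum.inl _ Sum.inl_injective hg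
  let w : l ⊕ m → ℂ := Sum.elim (fun k => U (e k).1.1 (e k).1.2) 1
  refine ⟨monomialMatrix σ w, monomialMatrix τ 1, ⟨σ, w, ?_, fun _ _ => rfl⟩,
    ⟨τ, 1, by simp, fun _ _ => rfl⟩, ?_⟩
  · rintro (k | k)
    · exact hpow _ _ (e k).2
    · simp [w]
  · ext i j
    obtain ⟨p, rfl⟩ := σ.surjective i
    obtain ⟨q, rfl⟩ := τ.surjective j
    rw [monomialMatrix_mul_conjTranspose_apply]
    by_cases h : ∃ k, p = Sum.inl k ∧ q = Sum.inl k
    · obtain ⟨k, rfl, rfl⟩ := h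
      simp [w, hσ, hτ]
    · have hJ := mt (partialOne_ne_zero_iff p q).1 h
      rw [not_not.1 hJ, mul_zero, zero_mul]
      by_contra hne
      obtain ⟨k, hk⟩ := e.surjective ⟨(σ p, τ q), hne⟩
      refine h ⟨k, σ.injective ?_, τ.injective ?_⟩
      · rw [hσ, hk]
      · rw [hτ, hk]

theorem mul_partialOne_mul_conjTranspose_eq_iff {s : ℕ} (hs : s ≠ 0)
    {A A' : Matrix (l ⊕ m) (l ⊕ m) ℂ} {B B' : Matrix (l ⊕ n) (l ⊕ n) ℂ}
    (hA : IsSignedPermMatrix s A) (hA' : IsSignedPermMatrix s A')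
    (hB : IsSignedPermMatrix s B) (hB' : IsSignedPermMatrix s B') :
    A * partialOne l m n * Bᴴ = A' * partialOne l m n * B'ᴴ ↔
      ∃ x a b, IsSignedPermMatrix s x ∧ IsSignedPermMatrix s a ∧ IsSignedPermMatrix s b ∧
        A' = A * fromBlocks x 0 0 a ∧ B' = B * fromBlocks x 0 0 b := by
  have hAA := hA.conjTranspose_mul_self hs
  have hBB := hB.conjTranspose_mul_self hs
  have hAA' := hA.mul_conjTranspose_self hs
  have hBB' := hB.mul_conjTranspose_self hs
  constructor
  · intro h
    have hstab : Aᴴ * A' * partialOne l m n * (Bᴴ * B')ᴴ =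
        partialOne l m n := by
      calc _ = Aᴴ * (A' * partialOne l m n * B'ᴴ) * B := by
            simp only [conjTranspose_mul, conjTranspose_conjTranspose, Matrix.mul_assoc]
        _ = (Aᴴ * A) * partialOne l m n * (Bᴴ * B) := by
            simp only [← h, Matrix.mul_assoc]
        _ = _ := by rw [hAA, hBB, Matrix.one_mul, Matrix.mul_one]
    obtain ⟨x, a, b, hx, ha, hb, hxa, hxb⟩ :=
      (mul_partialOne_mul_conjTranspose_eq_self_iff hs (hA.conjTranspose.mul hA')
        (hB.conjTranspose.mul hB')).1 hstab
    refine ⟨x, a, b, hx, ha, hb, ?_, ?_⟩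
    · rw [← hxa, ← Matrix.mul_assoc, hAA', Matrix.one_mul]
    · rw [← hxb, ← Matrix.mul_assoc, hBB', Matrix.one_mul]
  · rintro ⟨x, a, b, hx, ha, hb, rfl, rfl⟩
    have hstab := (mul_partialOne_mul_conjTranspose_eq_self_iff hs
      (hx.fromBlocks ha) (hx.fromBlocks hb)).2 ⟨x, a, b, hx, ha, hb, rfl, rfl⟩
    calc _ = A * (fromBlocks x 0 0 a * partialOne l m n * (fromBlocks x 0 0 b)ᴴ) * Bᴴ := by
          rw [hstab]
      _ = _ := by simp only [conjTranspose_mul, Matrix.mul_assoc]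

end

/-- With `J = fromBlocks 1 0 0 0` (upper-left block the L×L identity), a pair
`(A,B) ∈ H_M^s × H_N^s` satisfies `A * J * Bᴴ = J` iff `A = fromBlocks x 0 0 a` and
`B = fromBlocks x 0 0 b` with `x ∈ H_L^s`, `a ∈ H_{M-L}^s`, `b ∈ H_{N-L}^s`; hence the
stabilizer of `J` is isomorphic to `H_L^s × H_{M-L}^s × H_{N-L}^s`.  Moreover the map
`(A,B) ↦ A * J * Bᴴ` lands in `H_{MN}^{sL}`, is surjective onto `H_{MN}^{sL}`, and identifies
two pairs exactly when they lie in the same left coset, so that `H_{MN}^{sL}` is in bijection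
with the quotient `(H_M^s × H_N^s)/(H_L^s × H_{M-L}^s × H_{N-L}^s)`. -/
theorem stmt_12 (s L M N : ℕ) (hs : 1 ≤ s) (hLM : L ≤ M) (hMN : M ≤ N)
    (J : Matrix (Fin L ⊕ Fin (M - L)) (Fin L ⊕ Fin (N - L)) ℂ)
    (hJ : J = Matrix.fromBlocks 1 0 0 0) :
    (∀ (A : Matrix (Fin L ⊕ Fin (M - L)) (Fin L ⊕ Fin (M - L)) ℂ)
        (B : Matrix (Fin L ⊕ Fin (N - L)) (Fin L ⊕ Fin (N - L)) ℂ),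
      IsSignedPermMatrix s A → IsSignedPermMatrix s B →
      (A * J * Bᴴ = J ↔
        ∃ (x : Matrix (Fin L) (Fin L) ℂ) (a : Matrix (Fin (M - L)) (Fin (M - L)) ℂ)
          (b : Matrix (Fin (N - L)) (Fin (N - L)) ℂ),
          IsSignedPermMatrix s x ∧ IsSignedPermMatrix s a ∧ IsSignedPermMatrix s b ∧
          A = Matrix.fromBlocks x 0 0 a ∧ B = Matrix.fromBlocks x 0 0 b)) ∧
    (∀ (A : Matrix (Fin L ⊕ Fin (M - L)) (Fin L ⊕ Fin (M - L)) ℂ)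
        (B : Matrix (Fin L ⊕ Fin (N - L)) (Fin L ⊕ Fin (N - L)) ℂ),
      IsSignedPermMatrix s A → IsSignedPermMatrix s B →
      IsSignedPartialPermMatrix s L (A * J * Bᴴ)) ∧
    (∀ U : Matrix (Fin L ⊕ Fin (M - L)) (Fin L ⊕ Fin (N - L)) ℂ,
      IsSignedPartialPermMatrix s L U →
      ∃ (A : Matrix (Fin L ⊕ Fin (M - L)) (Fin L ⊕ Fin (M - L)) ℂ)
        (B : Matrix (Fin L ⊕ Fin (N - L)) (Fin L ⊕ Fin (N - L)) ℂ),
        IsSignedPermMatrix s A ∧ IsSignedPermMatrix s B ∧ U = A * J * Bᴴ) ∧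
    (∀ (A A' : Matrix (Fin L ⊕ Fin (M - L)) (Fin L ⊕ Fin (M - L)) ℂ)
        (B B' : Matrix (Fin L ⊕ Fin (N - L)) (Fin L ⊕ Fin (N - L)) ℂ),
      IsSignedPermMatrix s A → IsSignedPermMatrix s A' →
      IsSignedPermMatrix s B → IsSignedPermMatrix s B' →
      (A * J * Bᴴ = A' * J * B'ᴴ ↔
        ∃ (x : Matrix (Fin L) (Fin L) ℂ) (a : Matrix (Fin (M - L)) (Fin (M - L)) ℂ)
          (b : Matrix (Fin (N - L)) (Fin (N - L)) ℂ),
          IsSignedPermMatrix s x ∧ IsSignedPermMatrix s a ∧ IsSignedPermMatrix s b ∧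
          A' = A * Matrix.fromBlocks x 0 0 a ∧ B' = B * Matrix.fromBlocks x 0 0 b)) := by
  subst hJ
  have hs' : s ≠ 0 := Nat.one_le_iff_ne_zero.1 hs
  have hL : Nat.card (Fin L) = L := Nat.card_fin L
  refine ⟨fun A B hA hB => mul_partialOne_mul_conjTranspose_eq_self_iff hs' hA hB,
    fun A B hA hB => ?_, fun U hU => ?_, fun A A' B B' hA hA' hB hB' =>
      mul_partialOne_mul_conjTranspose_eq_iff hs' hA hA' hB hB'⟩
  · simpa only [hL] using hA.isSignedPartialPermMatrix hs' hB
  · exact IsSignedPartialPermMatrix.exists_eq_mul_mul_conjTranspose_s12 (by rwa [hL])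
end

section
/- Let s and L be natural numbers and let σ, ν be equivalence relations (setoids) on Fin s. Then the number of functions l : Fin s → Fin L satisfying ker l ≤ σ and ker l ≤ ν equals L^{|σ ⊔ ν|}, where σ ⊔ ν is the join of σ and ν in the lattice of equivalence relations on Fin s and |σ ⊔ ν| is its number of equivalence classes. -/
/-- For setoids (partitions) `σ, ν` on `Fin s`, the number of functions
`l : Fin s → Fin L` with `ker l ≤ σ` and `ker l ≤ ν` — i.e. constant on every block of `σ` and
of `ν`, which in Mathlib's order on `Setoid` reads `σ ≤ Setoid.ker l` and `ν ≤ Setoid.ker l` —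
equals `L ^ |σ ⊔ ν|`, where `|σ ⊔ ν|` is the number of classes of the join `σ ⊔ ν`. -/
theorem stmt_13 (s L : ℕ) (σ ν : Setoid (Fin s)) :
    Nat.card {l : Fin s → Fin L // σ ≤ Setoid.ker l ∧ ν ≤ Setoid.ker l} =
      L ^ Nat.card (Quotient (σ ⊔ ν)) := by
  simp_rw [← sup_le_iff]
  rw [Nat.card_congr (Setoid.liftEquiv (σ ⊔ ν)), Nat.card_fun, Nat.card_fin]
end

section
/- Let k ≥ 1 and let π, σ be equivalence relations on Fin (2k) each of whose equivalence classes has exactly 2 elements (pair partitions, or pairings). Then the number of equivalence classes of the join satisfies |π ⊔ σ| ≤ k, and |π ⊔ σ| = k if and only if π = σ. -/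
namespace Setoid

variable {α : Type*}

/-- If all classes of `s` have `d` elements, then `s` has `|α| / d` classes. -/
theorem card_quotient_mul_of_card_class_eq [Finite α] (s : Setoid α) (d : ℕ)
    (h : ∀ x, Nat.card {y // s.r x y} = d) : Nat.card (Quotient s) * d = Nat.card α := by
  have := Fintype.ofFinite (Quotient s)
  have hfiber (q : Quotient s) : Nat.card {y // Quotient.mk s y = q} = d := by
    induction q using Quotient.inductionOn with
    | h x =>
      rw [← h x]
      exact Nat.card_congr (Equiv.subtypeEquivRight fun y =>
        Quotient.eq.trans ⟨s.symm, s.symm⟩)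
  rw [← Nat.card_congr (Equiv.sigmaFiberEquiv (Quotient.mk s)), Nat.card_sigma]
  simp [hfiber]

theorem surjective_quotient_map_id {s t : Setoid α} (h : s ≤ t) :
    Function.Surjective (Quotient.map id h : Quotient s → Quotient t) :=
  Quotient.ind fun x => ⟨Quotient.mk s x, rfl⟩

theorem card_quotient_le_of_le [Finite α] {s t : Setoid α} (h : s ≤ t) :
    Nat.card (Quotient t) ≤ Nat.card (Quotient s) :=
  Nat.card_le_card_of_surjective _ (surjective_quotient_map_id h)

theorem eq_of_le_of_card_quotient_eq [Finite α] {s t : Setoid α} (h : s ≤ t)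
    (hcard : Nat.card (Quotient s) = Nat.card (Quotient t)) : s = t := by
  have hbij := (Nat.bijective_iff_surjective_and_card _).2 ⟨surjective_quotient_map_id h, hcard⟩
  refine le_antisymm h fun {x y} hxy => Quotient.exact (hbij.1 ?_)
  exact Quotient.sound hxy

end Setoid

/-- If `π, σ` are pairings of `2k` points (equivalence relations on `Fin (2k)`
all of whose classes have exactly 2 elements), then the number of classes of the join satisfies
`|π ⊔ σ| ≤ k`, with equality iff `π = σ`. -/
theorem stmt_14 (k : ℕ) (hk : 1 ≤ k) (π σ : Setoid (Fin (2 * k)))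
    (hπ : ∀ x, Nat.card {y // π.r x y} = 2)
    (hσ : ∀ x, Nat.card {y // σ.r x y} = 2) :
    Nat.card (Quotient (π ⊔ σ)) ≤ k ∧
    (Nat.card (Quotient (π ⊔ σ)) = k ↔ π = σ) := by
  have hcard (s : Setoid (Fin (2 * k))) (hs : ∀ x, Nat.card {y // s.r x y} = 2) :
      Nat.card (Quotient s) = k := by
    have := s.card_quotient_mul_of_card_class_eq 2 hs
    rw [Nat.card_fin] at this
    omega
  refine ⟨(Setoid.card_quotient_le_of_le le_sup_left).trans (hcard π hπ).le, fun h => ?_, ?_⟩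
  · exact (Setoid.eq_of_le_of_card_quotient_eq le_sup_left ((hcard π hπ).trans h.symm)).trans
      (Setoid.eq_of_le_of_card_quotient_eq le_sup_right ((hcard σ hσ).trans h.symm)).symm
  · rintro rfl
    rw [sup_idem]
    exact hcard π hπ
end

section
/- Let L ≤ M ≤ N be natural numbers, let J be the M×N real matrix fromBlocks 1 0 0 0 with upper-left block the L×L identity, and let μ be the pushforward of the Haar probability measure on O(M) × O(N) under (A,B) ↦ A·J·Bᵀ. Suppose ρ is a Borel probability measure on the space of M×N real matrices such that ρ gives full measure 1 to the set O_{MN}^L = {U : U·Uᵀ·U = U, trace(U·Uᵀ) = L}, and such that for every A ∈ O(M) and B ∈ O(N) the pushforward of ρ under U ↦ A·U·Bᵀ equals ρ. Then ρ = μ. -/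
open Matrix MeasureTheory

/-- The (Borel) measurable structure on matrices, coming from the product structure. -/
noncomputable instance matrixMeasurableSpace {m n α : Type*} [MeasurableSpace α] :
    MeasurableSpace (Matrix m n α) :=
  inferInstanceAs (MeasurableSpace (m → n → α))

section PartialIsometry

variable {l m p q : Type*} [DecidableEq l] [Fintype m]

/-- A matrix has orthonormal columns iff its transpose is a left inverse. -/
theorem transpose_mul_self_eq_one_iff_orthonormal (V : Matrix m l ℝ) :
    Vᵀ * V = 1 ↔ Orthonormal ℝ fun j => (WithLp.toLp 2 (V.col j) : EuclideanSpace ℝ m) := by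
  rw [orthonormal_iff_ite, ← Matrix.ext_iff]
  refine forall₂_congr fun i j => ?_
  simp [Matrix.mul_apply, Matrix.one_apply, PiLp.inner_apply, mul_comm]

variable [Fintype l] [DecidableEq m] [Fintype p] [DecidableEq p] [Fintype q] [DecidableEq q]

/-- A matrix with orthonormal columns extends to an orthogonal matrix. -/
theorem exists_orthogonal_fromCols (V : Matrix (l ⊕ q) l ℝ) (hV : Vᵀ * V = 1) :
    ∃ V' : Matrix (l ⊕ q) q ℝ, fromCols V V' ∈ orthogonalGroup (l ⊕ q) ℝ := by
  let v : l ⊕ q → EuclideanSpace ℝ (l ⊕ q) := Sum.elim (fun j => WithLp.toLp 2 (V.col j)) 0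
  have hv : Orthonormal ℝ ((Set.range Sum.inl).domRestrict v) := by
    have h := (transpose_mul_self_eq_one_iff_orthonormal V).1 hV
    rw [orthonormal_iff_ite] at h ⊢
    rintro ⟨_, i, rfl⟩ ⟨_, j, rfl⟩
    simpa [v, Subtype.ext_iff] using h i j
  obtain ⟨b, hb⟩ := hv.exists_orthonormalBasis_extension_of_card_eq (by simp)
  refine ⟨of fun i j => b (Sum.inr j) i, (mem_orthogonalGroup_iff' _ _).2 ?_⟩
  rw [transpose_mul_self_eq_one_iff_orthonormal]
  suffices h : ∀ j, (WithLp.toLp 2 ((fromCols V (of fun i j => b (Sum.inr j) i)).col j) :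
      EuclideanSpace ℝ (l ⊕ q)) = b j by
    simpa only [h] using b.orthonormal
  intro j
  ext i
  rcases j with j | j
  · simp [hb (Sum.inl j) ⟨j, rfl⟩, v]
  · simp

/-- A symmetric idempotent matrix of trace `card l` factors through a matrix with `l`-indexed
orthonormal columns. -/
theorem exists_mul_transpose_eq_of_isIdempotentElem (Q : Matrix m m ℝ) (hsymm : Qᵀ = Q)
    (hidem : Q * Q = Q) (htr : Q.trace = Fintype.card l) :
    ∃ W : Matrix m l ℝ, Wᵀ * W = 1 ∧ W * Wᵀ = Q := by
  let T := toLpLin 2 2 Q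
  have hT : IsIdempotentElem T := by
    change T * T = T
    rw [Module.End.mul_eq_comp, ← toLpLin_mul, hidem]
  have hproj := LinearMap.IsIdempotentElem.isProj_range T hT
  have hrank : Module.finrank ℝ (LinearMap.range T) = Fintype.card l := by
    have h := hproj.trace
    rw [LinearMap.trace_eq_matrix_trace ℝ (PiLp.basisFun 2 ℝ m),
      show T = toLin (PiLp.basisFun 2 ℝ m) (PiLp.basisFun 2 ℝ m) Q from
        LinearEquiv.congr_fun (toLpLin_eq_toLin 2 2) Q,
      LinearMap.toMatrix_toLin, htr] at h
    exact_mod_cast h.symm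
  let b := (stdOrthonormalBasis ℝ (LinearMap.range T)).reindex
    ((finCongr hrank).trans (Fintype.equivFin l).symm)
  let W : Matrix m l ℝ := of fun i j => (b j : EuclideanSpace ℝ m) i
  have hW : Wᵀ * W = 1 := by
    rw [transpose_mul_self_eq_one_iff_orthonormal]
    exact b.orthonormal.comp_linearIsometry (LinearMap.range T).subtypeₗᵢ
  have hQW : Q * W = W := by
    ext i j
    exact congrFun (congrArg WithLp.ofLp (hproj.map_id (b j) (b j).2)) i
  have hWQ : Wᵀ * Q = Wᵀ := by
    simpa [hsymm] using congrArg transpose hQW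
  refine ⟨W, hW, ?_⟩
  have hR : (Q - W * Wᵀ)ᵀ * (Q - W * Wᵀ) = Q - W * Wᵀ := by
    have h₁ : Q * (W * Wᵀ) = W * Wᵀ := by rw [← Matrix.mul_assoc, hQW]
    have h₂ : W * Wᵀ * Q = W * Wᵀ := by rw [Matrix.mul_assoc, hWQ]
    have h₃ : W * Wᵀ * (W * Wᵀ) = W * Wᵀ := by
      rw [Matrix.mul_assoc, ← Matrix.mul_assoc Wᵀ, hW, Matrix.one_mul]
    simp [hsymm, Matrix.sub_mul, Matrix.mul_sub, hidem, h₁, h₂, h₃]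
  have h0 : Q - W * Wᵀ = 0 := by
    rw [← trace_conjTranspose_mul_self_eq_zero_iff, conjTranspose_eq_transpose_of_trivial, hR,
      trace_sub, trace_mul_comm, hW, htr, trace_one, sub_self]
  exact (sub_eq_zero.1 h0).symm

/-- A partial isometry of rank `card l` lies in the orbit of `fromBlocks 1 0 0 0`. -/
theorem exists_orthogonal_mul_fromBlocks_mul_transpose (U : Matrix (l ⊕ p) (l ⊕ q) ℝ)
    (hU : U * Uᵀ * U = U) (htr : (U * Uᵀ).trace = Fintype.card l) :
    ∃ A ∈ orthogonalGroup (l ⊕ p) ℝ, ∃ B ∈ orthogonalGroup (l ⊕ q) ℝ,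
      U = A * (fromBlocks 1 0 0 0 : Matrix (l ⊕ p) (l ⊕ q) ℝ) * Bᵀ := by
  obtain ⟨W, hW, hWQ⟩ := exists_mul_transpose_eq_of_isIdempotentElem (U * Uᵀ) (by simp)
    (by rw [← Matrix.mul_assoc, hU]) htr
  have hV : (Uᵀ * W)ᵀ * (Uᵀ * W) = 1 := by
    rw [transpose_mul, transpose_transpose, Matrix.mul_assoc, ← Matrix.mul_assoc U, ← hWQ,
      Matrix.mul_assoc, hW, Matrix.mul_one, hW]
  obtain ⟨W', hA⟩ := exists_orthogonal_fromCols W hW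
  obtain ⟨V', hB⟩ := exists_orthogonal_fromCols (Uᵀ * W) hV
  refine ⟨_, hA, _, hB, ?_⟩
  rw [fromCols_mul_fromBlocks, transpose_fromCols, fromCols_mul_fromRows]
  simp [← Matrix.mul_assoc, hWQ, hU]

end PartialIsometry

section Measurability

variable {l m n α : Type*} [MeasurableSpace α] [Fintype l]

theorem measurable_matrix_iff {f : α → Matrix m n ℝ} :
    Measurable f ↔ ∀ i j, Measurable fun a => f a i j :=
  measurable_pi_iff.trans (forall_congr' fun _ => measurable_pi_iff)

theorem Measurable.matrix_apply {f : α → Matrix m n ℝ} (hf : Measurable f) (i : m) (j : n) :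
    Measurable fun a => f a i j :=
  measurable_matrix_iff.1 hf i j

theorem Measurable.matrix_mul {f : α → Matrix m l ℝ} {g : α → Matrix l n ℝ}
    (hf : Measurable f) (hg : Measurable g) : Measurable fun a => f a * g a := by
  refine measurable_matrix_iff.2 fun i j => ?_
  simp only [Matrix.mul_apply]
  exact Finset.measurable_sum _ fun k _ => (hf.matrix_apply i k).mul (hg.matrix_apply k j)

theorem Measurable.matrix_transpose {f : α → Matrix m n ℝ} (hf : Measurable f) :
    Measurable fun a => (f a)ᵀ :=
  measurable_matrix_iff.2 fun i j => hf.matrix_apply j i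

theorem measurableSet_partialIsometry_trace_eq [Fintype m] [Fintype n] (c : ℝ) :
    MeasurableSet {U : Matrix m n ℝ | U * Uᵀ * U = U ∧ (U * Uᵀ).trace = c} := by
  have hm : Measurable fun U : Matrix m n ℝ => U * Uᵀ :=
    measurable_id.matrix_mul measurable_id.matrix_transpose
  refine MeasurableSet.inter ?_ ?_
  · have : {U : Matrix m n ℝ | U * Uᵀ * U = U} = ⋂ i, ⋂ j, {U | (U * Uᵀ * U) i j = U i j} := by
      ext U
      simp [← Matrix.ext_iff]
    change MeasurableSet {U : Matrix m n ℝ | U * Uᵀ * U = U}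
    rw [this]
    exact .iInter fun i => .iInter fun j => measurableSet_eq_fun
      ((hm.matrix_mul measurable_id).matrix_apply i j) (measurable_id.matrix_apply i j)
  · exact measurableSet_eq_fun (Finset.measurable_sum _ fun i _ => hm.matrix_apply i i)
      measurable_const

end Measurability

/-- A probability measure invariant under every `x ↦ f g x` is the pushforward of any probability
measure `h` under `g ↦ f g x₀`, provided that almost every orbit map has the same law. -/
theorem eq_map_of_invariant_of_ae_map_eq {G X : Type*} [MeasurableSpace G] [MeasurableSpace X]
    {f : G → X → X} (hf : Measurable (Function.uncurry f)) {h : Measure G}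
    [IsProbabilityMeasure h] {ρ μ : Measure X} [IsProbabilityMeasure ρ]
    (hinv : ∀ g, ρ.map (f g) = ρ) (hae : ∀ᵐ x ∂ρ, h.map (fun g => f g x) = μ) : ρ = μ := by
  ext S hS
  have h₁ : (h.prod ρ) (Function.uncurry f ⁻¹' S) = ρ S := by
    rw [Measure.prod_apply (hf hS)]
    have (g : G) : ρ (Prod.mk g ⁻¹' (Function.uncurry f ⁻¹' S)) = ρ S := by
      conv_rhs => rw [← hinv g, Measure.map_apply hf.of_uncurry_left hS]
      rfl
    simp [this]
  have h₂ : (h.prod ρ) (Function.uncurry f ⁻¹' S) = μ S := by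
    rw [Measure.prod_apply_symm (hf hS)]
    have : ∀ᵐ x ∂ρ, h ((fun g => (g, x)) ⁻¹' (Function.uncurry f ⁻¹' S)) = μ S := by
      filter_upwards [hae] with x hx
      rw [← hx, Measure.map_apply hf.of_uncurry_right hS]
      rfl
    simp [lintegral_congr_ae this]
  rw [← h₁, h₂]

/-- Let `J = fromBlocks 1 0 0 0` and let `μ` be the pushforward of the Haar
probability measure `h` on `O(M) × O(N)` (its unique left- and right-invariant Borel
probability measure) under `(A,B) ↦ A * J * Bᵀ`.  If `ρ` is a Borel probability measure on the
M×N real matrices giving full measure to `O_{MN}^L = {U | U * Uᵀ * U = U, trace (U * Uᵀ) = L}`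
and invariant under `U ↦ A * U * Bᵀ` for all orthogonal `A, B`, then `ρ = μ`. -/
theorem stmt_17 (L M N : ℕ) (hLM : L ≤ M) (hMN : M ≤ N)
    (J : Matrix (Fin L ⊕ Fin (M - L)) (Fin L ⊕ Fin (N - L)) ℝ)
    (hJ : J = Matrix.fromBlocks 1 0 0 0)
    (h : Measure (↥(Matrix.orthogonalGroup (Fin L ⊕ Fin (M - L)) ℝ) ×
      ↥(Matrix.orthogonalGroup (Fin L ⊕ Fin (N - L)) ℝ)))
    [IsProbabilityMeasure h] [h.IsMulLeftInvariant] [h.IsMulRightInvariant]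
    (μ ρ : Measure (Matrix (Fin L ⊕ Fin (M - L)) (Fin L ⊕ Fin (N - L)) ℝ))
    (hμ : μ = Measure.map
      (fun p : ↥(Matrix.orthogonalGroup (Fin L ⊕ Fin (M - L)) ℝ) ×
          ↥(Matrix.orthogonalGroup (Fin L ⊕ Fin (N - L)) ℝ) =>
        (p.1 : Matrix (Fin L ⊕ Fin (M - L)) (Fin L ⊕ Fin (M - L)) ℝ) * J *
          (p.2 : Matrix (Fin L ⊕ Fin (N - L)) (Fin L ⊕ Fin (N - L)) ℝ)ᵀ) h)
    [IsProbabilityMeasure ρ]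
    (hρfull : ρ {U : Matrix (Fin L ⊕ Fin (M - L)) (Fin L ⊕ Fin (N - L)) ℝ |
      U * Uᵀ * U = U ∧ (U * Uᵀ).trace = (L : ℝ)} = 1)
    (hρinv : ∀ A ∈ Matrix.orthogonalGroup (Fin L ⊕ Fin (M - L)) ℝ,
      ∀ B ∈ Matrix.orthogonalGroup (Fin L ⊕ Fin (N - L)) ℝ,
        Measure.map (fun U => A * U * Bᵀ) ρ = ρ) :
    ρ = μ := by
  subst hJ hμ
  have hf : Measurable (Function.uncurry
      fun (p : ↥(Matrix.orthogonalGroup (Fin L ⊕ Fin (M - L)) ℝ) ×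
          ↥(Matrix.orthogonalGroup (Fin L ⊕ Fin (N - L)) ℝ))
        (U : Matrix (Fin L ⊕ Fin (M - L)) (Fin L ⊕ Fin (N - L)) ℝ) =>
          (p.1 : Matrix (Fin L ⊕ Fin (M - L)) (Fin L ⊕ Fin (M - L)) ℝ) * U *
            (p.2 : Matrix (Fin L ⊕ Fin (N - L)) (Fin L ⊕ Fin (N - L)) ℝ)ᵀ) :=
    ((measurable_subtype_coe.comp (measurable_fst.comp measurable_fst)).matrix_mul
      measurable_snd).matrix_mul
        (measurable_subtype_coe.comp (measurable_snd.comp measurable_fst)).matrix_transpose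
  refine eq_map_of_invariant_of_ae_map_eq hf (h := h) (fun g => hρinv _ g.1.2 _ g.2.2) ?_
  have hae := (mem_ae_iff_prob_eq_one (measurableSet_partialIsometry_trace_eq (L : ℝ))).2 hρfull
  filter_upwards [hae] with U hU
  obtain ⟨A, hA, B, hB, rfl⟩ :=
    exists_orthogonal_mul_fromBlocks_mul_transpose U hU.1 (by simpa using hU.2)
  let g : ↥(Matrix.orthogonalGroup (Fin L ⊕ Fin (M - L)) ℝ) ×
    ↥(Matrix.orthogonalGroup (Fin L ⊕ Fin (N - L)) ℝ) := (⟨A, hA⟩, ⟨B, hB⟩)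
  have hg : Measurable fun x => x * g :=
    (Measurable.subtype_mk ((measurable_subtype_coe.comp measurable_fst).matrix_mul
      measurable_const)).prodMk
    (Measurable.subtype_mk ((measurable_subtype_coe.comp measurable_snd).matrix_mul
      measurable_const))
  conv_rhs => rw [← map_mul_right_eq_self h g, Measure.map_map hf.of_uncurry_right hg]
  congr 1
  funext x
  simp [g, Matrix.mul_assoc]
end

section
/- Let k ≥ 1, s = 2k, and let L ≤ M ≤ N be natural numbers with s ≤ M. Let P₂(s) be the (finite) set of equivalence relations on Fin s all of whose classes have exactly 2 elements. Define the Gram matrices G_{sM}, G_{sN}, indexed by P₂(s), by G_{sM}(π,σ) = M^{|π ⊔ σ|} and G_{sN}(π,σ) = N^{|π ⊔ σ|} (real entries), assume both are invertible, and let W_{sM} = G_{sM}⁻¹, W_{sN} = G_{sN}⁻¹. Let μ be the pushforward of the Haar probability measure on O(M) × O(N) under (A,B) ↦ A·J·Bᵀ, where J = fromBlocks 1 0 0 0 with upper-left block the L×L identity. Then for all i : Fin s → Fin M and j : Fin s → Fin N: ∫ ∏_{r} U_{i(r), j(r)} dμ(U) = ∑_{π,σ,τ,ν ∈ P₂(s)}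 L^{|σ ⊔ ν|} δ_π(i) δ_τ(j) W_{sM}(π,σ) W_{sN}(τ,ν), where δ_π(i) = 1 if i is constant on each block of π and 0 otherwise. -/
open Matrix MeasureTheory
open scoped Classical

instance setoidFinite {α : Type*} [Finite α] : Finite (Setoid α) :=
  Finite.of_injective (fun s : Setoid α => s.r) fun a b h => by
    cases a; cases b; simp only at h; subst h; rfl

noncomputable instance setoidFintype {α : Type*} [Finite α] : Fintype (Setoid α) :=
  Fintype.ofFinite _

/-- A pairing: an equivalence relation all of whose classes have exactly 2 elements. -/
def IsPairing {n : ℕ} (π : Setoid (Fin n)) : Prop :=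
  ∀ x, Nat.card {y // π.r x y} = 2

/-- The Kronecker symbol `δ_π(i)`: `1` if `i` is constant on the classes of `π`, else `0`. -/
noncomputable def kerDelta {α m : Type*} (π : Setoid α) (i : α → m) : ℝ :=
  if π ≤ Setoid.ker i then 1 else 0

theorem sum_kerDelta_mul {α m : Type*} [Fintype α] [DecidableEq α] [Fintype m]
    (π : Setoid α) (f : (α → m) → ℝ) :
    ∑ i, kerDelta π i * f i = ∑ q : Quotient π → m, f (fun x => q (Quotient.mk π x)) := by
  simp only [kerDelta, ite_mul, one_mul, zero_mul]
  rw [← Finset.sum_filter, Finset.sum_subtype _ fun i => Finset.mem_filter_univ i]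
  exact Fintype.sum_equiv (Setoid.liftEquiv π) _ _ fun _ => rfl

theorem sum_kerDelta_mul_kerDelta {α m : Type*} [Fintype α] [DecidableEq α] [Fintype m]
    (π σ : Setoid α) :
    ∑ i : α → m, kerDelta π i * kerDelta σ i =
      (Fintype.card m : ℝ) ^ Nat.card (Quotient (π ⊔ σ)) := by
  have key : ∀ i : α → m, kerDelta π i * kerDelta σ i = kerDelta (π ⊔ σ) i * 1 := by
    intro i
    simp only [kerDelta, sup_le_iff]
    split_ifs <;> simp_all
  rw [Finset.sum_congr rfl fun i _ => key i, sum_kerDelta_mul]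
  simp [Nat.card_eq_fintype_card]

theorem sum_kerDelta_mul_prod_one {α m : Type*} [Fintype α] [DecidableEq α] [Fintype m]
    [DecidableEq m] (π : Setoid α) (a : α → m) :
    ∑ i, kerDelta π i * ∏ r, (1 : Matrix m m ℝ) (i r) (a r) = kerDelta π a := by
  rw [Finset.sum_eq_single a]
  · simp
  · intro i _ hi
    obtain ⟨r, hr⟩ := Function.ne_iff.mp hi
    have h0 : (1 : Matrix m m ℝ) (i r) (a r) = 0 := Matrix.one_apply_ne hr
    exact mul_eq_zero_of_right _ (Finset.prod_eq_zero (Finset.mem_univ r) h0)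
  · simp

theorem sum_kerDelta_mul_prod {α m n : Type*} [Fintype α] [DecidableEq α] [Fintype m]
    (π : Setoid α) (X : Matrix m n ℝ) (a : α → n) :
    ∑ i, kerDelta π i * ∏ r, X (i r) (a r) =
      ∏ q : Quotient π, ∑ x, ∏ r with Quotient.mk π r = q, X x (a r) := by
  rw [sum_kerDelta_mul, Fintype.prod_sum]
  refine Finset.sum_congr rfl fun q _ => ?_
  rw [← Finset.prod_fiberwise Finset.univ (Quotient.mk π)]
  refine Finset.prod_congr rfl fun c _ => Finset.prod_congr rfl fun r hr => ?_
  obtain rfl := (Finset.mem_filter.mp hr).2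
  rfl

/-- Contracting the rows of a tensor power along a pairing only depends on the Gram matrix. -/
theorem sum_kerDelta_mul_prod_congr {s : ℕ} {π : Setoid (Fin s)} (hπ : IsPairing π)
    {m m' n : Type*} [Fintype m] [Fintype m'] {X : Matrix m n ℝ} {Y : Matrix m' n ℝ}
    (hXY : Xᵀ * X = Yᵀ * Y) (a : Fin s → n) :
    ∑ i, kerDelta π i * ∏ r, X (i r) (a r) = ∑ i, kerDelta π i * ∏ r, Y (i r) (a r) := by
  rw [sum_kerDelta_mul_prod, sum_kerDelta_mul_prod]
  refine Finset.prod_congr rfl fun q _ => ?_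
  obtain ⟨x, rfl⟩ := Quotient.exists_rep q
  have hcard : (Finset.univ.filter fun r => Quotient.mk π r = Quotient.mk π x).card = 2 := by
    rw [← hπ x, Nat.card_eq_fintype_card, Fintype.card_subtype]
    congr 1
    ext r
    simp only [Finset.mem_filter, Finset.mem_univ, true_and]
    exact ⟨fun h => π.symm (Quotient.exact h), fun h => Quotient.sound (π.symm h)⟩
  obtain ⟨u, v, huv, hset⟩ := Finset.card_eq_two.mp hcard
  rw [hset]
  simp only [Finset.prod_pair huv]
  exact congrFun (congrFun hXY (a u)) (a v)

/-- Invariance of a tensor of order `s` under the diagonal action of the orthogonal group. -/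
def IsOrthogonalInvariant {s M : ℕ} (T : (Fin s → Fin M) → ℝ) : Prop :=
  ∀ g ∈ Matrix.orthogonalGroup (Fin M) ℝ, ∀ i,
    ∑ i', (∏ r, g (i r) (i' r)) * T i' = T i

theorem isOrthogonalInvariant_kerDelta {s M : ℕ} {π : Setoid (Fin s)} (hπ : IsPairing π) :
    IsOrthogonalInvariant (M := M) (kerDelta π) := by
  intro g hg i
  have hg' : gᵀᵀ * gᵀ = (1 : Matrix (Fin M) (Fin M) ℝ)ᵀ * 1 := by
    simpa using (Matrix.mem_orthogonalGroup_iff (Fin M) ℝ).mp hg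
  have := sum_kerDelta_mul_prod_congr hπ hg' i
  rw [sum_kerDelta_mul_prod_one] at this
  simpa [mul_comm] using this

namespace IsOrthogonalInvariant

variable {s M : ℕ} {T : (Fin s → Fin M) → ℝ}

theorem sub {T' : (Fin s → Fin M) → ℝ} (hT : IsOrthogonalInvariant T)
    (hT' : IsOrthogonalInvariant T') : IsOrthogonalInvariant (fun i => T i - T' i) := by
  intro g hg i
  simp only [mul_sub, Finset.sum_sub_distrib, hT g hg i, hT' g hg i]

theorem linearCombination {ι : Type*} [Fintype ι] (c : ι → ℝ) {V : ι → (Fin s → Fin M) → ℝ}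
    (hV : ∀ x, IsOrthogonalInvariant (V x)) :
    IsOrthogonalInvariant (fun i => ∑ x, c x * V x i) := by
  intro g hg i
  simp only [Finset.mul_sum]
  rw [Finset.sum_comm]
  refine Finset.sum_congr rfl fun x _ => ?_
  rw [← hV x g hg i, Finset.mul_sum]
  exact Finset.sum_congr rfl fun _ _ => by ring

/-- Invariance under monomial matrices with entries `±1`. -/
theorem apply_signedPerm (hT : IsOrthogonalInvariant T) (e : Equiv.Perm (Fin M))
    (d : Fin M → ℝ) (hd : ∀ a, d a * d a = 1) (i : Fin s → Fin M) :
    (∏ r, d (i r)) * T (fun r => e (i r)) = T i := by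
  have hg : (Matrix.of fun a b => if e a = b then d a else 0) ∈
      Matrix.orthogonalGroup (Fin M) ℝ := by
    rw [Matrix.mem_orthogonalGroup_iff]
    ext a b
    by_cases hab : a = b
    · subst hab; simp [Matrix.mul_apply, hd]
    · simp [Matrix.mul_apply, hab]
  rw [← hT _ hg i, Finset.sum_eq_single (fun r => e (i r))]
  · simp
  · intro j _ hj
    obtain ⟨r, hr⟩ := Function.ne_iff.mp hj
    rw [Finset.prod_eq_zero (Finset.mem_univ r), zero_mul]
    simp [Ne.symm hr]
  · simp

theorem apply_perm (hT : IsOrthogonalInvariant T) (e : Equiv.Perm (Fin M))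
    (i : Fin s → Fin M) : T (fun r => e (i r)) = T i := by
  simpa using hT.apply_signedPerm e (fun _ => 1) (by simp) i

theorem apply_eq_of_ker_eq (hT : IsOrthogonalInvariant T) {i j : Fin s → Fin M}
    (hij : Setoid.ker i = Setoid.ker j) : T i = T j := by
  let f : {x // x ∈ Set.range i} ≃ {x // x ∈ Set.range j} :=
    (Setoid.quotientKerEquivRange i).symm.trans
      ((Quotient.congrRight fun a b => by
        exact iff_of_eq (congrArg (fun σ : Setoid (Fin s) => σ a b) hij)).trans
        (Setoid.quotientKerEquivRange j))
  have hf : ∀ r, f ⟨i r, r, rfl⟩ = ⟨j r, r, rfl⟩ := by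
    intro r
    have : (Setoid.quotientKerEquivRange i).symm ⟨i r, r, rfl⟩ = Quotient.mk _ r := by
      rw [Equiv.symm_apply_eq]; rfl
    simp only [f, Equiv.trans_apply, this]
    rfl
  rw [← hT.apply_perm f.extendSubtype i]
  congr 1
  ext r
  rw [Equiv.extendSubtype_apply_of_mem f (i r) ⟨r, rfl⟩, hf]

theorem apply_eq_zero_of_card_fiber_eq_one (hT : IsOrthogonalInvariant T)
    {i : Fin s → Fin M} {a : Fin M} (ha : (Finset.univ.filter fun r => i r = a).card = 1) :
    T i = 0 := by
  have h := hT.apply_signedPerm 1 (fun x => if x = a then -1 else 1)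
    (fun x => by split_ifs <;> norm_num) i
  rw [Finset.prod_ite, Finset.prod_const, ha] at h
  simp at h
  linarith

/-- The reflection with entries `3/5, 4/5, 4/5, -3/5` in the plane spanned by the basis vectors
`a` and `b`. -/
theorem exists_planeReflection {a b : Fin M} (hab : a ≠ b) :
    ∃ H ∈ Matrix.orthogonalGroup (Fin M) ℝ, H a a = 3 / 5 ∧ H a b = 4 / 5 ∧
      (∀ x, x ≠ a → x ≠ b → H a x = 0) ∧
      ∀ x, x ≠ a → x ≠ b → ∀ y, H x y = if x = y then 1 else 0 := by
  let v : Fin M → ℝ := fun x => if x = a then 1 else if x = b then -2 else 0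
  have hv : v ⬝ᵥ v = 5 := by
    have : ∀ x, v x * v x = (if x = a then 1 else 0) + (if x = b then 4 else 0) := by
      intro x
      by_cases hxa : x = a
      · subst hxa; simp [v, hab]
      · by_cases hxb : x = b
        · subst hxb; simp [v, hxa]; norm_num
        · simp [v, hxa, hxb]
    simp only [dotProduct, this, Finset.sum_add_distrib]
    simp
    norm_num
  refine ⟨1 - (2 / 5 : ℝ) • Matrix.vecMulVec v v, ?_, ?_, ?_, ?_, ?_⟩
  · rw [Matrix.mem_orthogonalGroup_iff]
    simp only [Matrix.transpose_sub, Matrix.transpose_one, Matrix.transpose_smul,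
      Matrix.transpose_vecMulVec, sub_mul, mul_sub, one_mul, mul_one, Matrix.smul_mul,
      Matrix.mul_smul, Matrix.vecMulVec_mul_vecMulVec, hv]
    ext x y
    simp [Matrix.vecMulVec_apply]
    ring
  · simp [Matrix.vecMulVec_apply, v]; norm_num
  · simp [Matrix.vecMulVec_apply, v, hab, hab.symm]; norm_num
  · intro x hxa hxb
    simp [Matrix.vecMulVec_apply, v, hxa, hxb, hxa.symm]
  · intro x hxa hxb y
    simp [Matrix.vecMulVec_apply, v, hxa, hxb, Matrix.one_apply]

theorem apply_eq_zero_of_three_le_card_fiber (hT : IsOrthogonalInvariant T)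
    {i : Fin s → Fin M} {a b : Fin M}
    (ha : 3 ≤ (Finset.univ.filter fun r => i r = a).card) (hb : ∀ r, i r ≠ b)
    (ih : ∀ j : Fin s → Fin M,
      (Finset.univ.image i).card < (Finset.univ.image j).card → T j = 0) :
    T i = 0 := by
  set n := (Finset.univ.filter fun r => i r = a).card with hn
  obtain ⟨r₀, hr₀⟩ : (Finset.univ.filter fun r => i r = a).Nonempty := by
    rw [← Finset.card_pos]; omega
  have hr₀ : i r₀ = a := by simpa using hr₀
  have hab : a ≠ b := fun h => hb r₀ (hr₀.trans h)
  obtain ⟨H, hH, haa, hHab, hax, hxy⟩ := exists_planeReflection hab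
  let i' : Fin s → Fin M := fun r => Equiv.swap a b (i r)
  have hi' : T i' = T i := hT.apply_perm (Equiv.swap a b) i
  have hii' : i ≠ i' := fun h => hab (by
    have := congrFun h r₀
    simpa [i', hr₀] using this)
  have hprod : ∏ r, H (i r) (i r) = (3 / 5) ^ n := by
    have : ∀ r, H (i r) (i r) = if i r = a then 3 / 5 else 1 := by
      intro r
      split_ifs with h
      · rw [h, haa]
      · rw [hxy _ h (hb r), if_pos rfl]
    simp only [this, Finset.prod_ite, Finset.prod_const, one_pow, mul_one, hn]
  have hprod' : ∏ r, H (i r) (i' r) = (4 / 5) ^ n := by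
    have : ∀ r, H (i r) (i' r) = if i r = a then 4 / 5 else 1 := by
      intro r
      split_ifs with h
      · simp only [i', h, Equiv.swap_apply_left, hHab]
      · simp only [i', Equiv.swap_apply_of_ne_of_ne h (hb r)]
        rw [hxy _ h (hb r), if_pos rfl]
    simp only [this, Finset.prod_ite, Finset.prod_const, one_pow, mul_one, hn]
  have hzero : ∀ j, j ≠ i ∧ j ≠ i' → (∏ r, H (i r) (j r)) * T j = 0 := by
    rintro j ⟨hji, hji'⟩
    by_cases hp : ∏ r, H (i r) (j r) = 0
    · rw [hp, zero_mul]
    have hne : ∀ r, H (i r) (j r) ≠ 0 := fun r => Finset.prod_ne_zero_iff.mp hp r (by simp)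
    have hfar : ∀ r, i r ≠ a → j r = i r := by
      intro r hr
      by_contra hcon
      exact hne r (by rw [hxy _ hr (hb r), if_neg (Ne.symm hcon)])
    have hnear : ∀ r, i r = a → j r = a ∨ j r = b := by
      intro r hr
      by_contra! hcon
      exact hne r (by rw [hr, hax _ hcon.1 hcon.2])
    have hja : ∃ r, j r = a := by
      by_contra! hcon
      refine hji' (funext fun r => ?_)
      by_cases hr : i r = a
      · simpa [i', hr] using (hnear r hr).resolve_left (hcon r)
      · rw [hfar r hr]
        simp [i', Equiv.swap_apply_of_ne_of_ne hr (hb r)]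
    have hjb : ∃ r, j r = b := by
      by_contra! hcon
      refine hji (funext fun r => ?_)
      by_cases hr : i r = a
      · rw [hr]; exact (hnear r hr).resolve_right (hcon r)
      · exact hfar r hr
    rw [ih j, mul_zero]
    refine Finset.card_lt_card ((Finset.ssubset_iff_of_subset ?_).mpr ⟨b, ?_, ?_⟩)
    · intro x hx
      obtain ⟨r, -, rfl⟩ := Finset.mem_image.mp hx
      by_cases hr : i r = a
      · rw [hr]; simpa using hja
      · rw [← hfar r hr]; simp
    · simpa using hjb
    · simpa using hb
  have hsum := hT H hH i
  rw [Fintype.sum_eq_add i i' hii' hzero, hprod, hprod', hi'] at hsum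
  have h3 : (3 / 5 : ℝ) ^ n ≤ (3 / 5) ^ 3 := pow_le_pow_of_le_one (by norm_num) (by norm_num) ha
  have h4 : (4 / 5 : ℝ) ^ n ≤ (4 / 5) ^ 3 := pow_le_pow_of_le_one (by norm_num) (by norm_num) ha
  have hfac : (1 - (3 / 5 : ℝ) ^ n - (4 / 5) ^ n) * T i = 0 := by linarith
  refine (mul_eq_zero.mp hfac).resolve_left (ne_of_gt ?_)
  norm_num at h3 h4
  linarith

theorem eq_zero_of_pairing (hT : IsOrthogonalInvariant T) (hsM : s ≤ M)
    (h0 : ∀ i, IsPairing (Setoid.ker i) → T i = 0) (i : Fin s → Fin M) : T i = 0 := by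
  induction hd : s - (Finset.univ.image i).card using Nat.strong_induction_on generalizing i with
  | _ d ih =>
    by_cases h1 : ∃ a, (Finset.univ.filter fun r => i r = a).card = 1
    · obtain ⟨a, ha⟩ := h1
      exact hT.apply_eq_zero_of_card_fiber_eq_one ha
    by_cases h3 : ∃ a, 3 ≤ (Finset.univ.filter fun r => i r = a).card
    · obtain ⟨a, ha⟩ := h3
      have hle : ∀ j : Fin s → Fin M, (Finset.univ.image j).card ≤ s := fun j => by
        simpa using Finset.card_image_le (s := Finset.univ) (f := j)
      have hlt : (Finset.univ.image i).card < s := by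
        refine lt_of_le_of_ne (hle i) fun h => ?_
        have hinj : Function.Injective i := by
          refine Set.injOn_univ.mp ?_
          rw [← Finset.coe_univ, ← Finset.card_image_iff, h]
          simp
        have : (Finset.univ.filter fun r => i r = a).card ≤ 1 :=
          Finset.card_le_one.mpr fun x hx y hy => hinj (by simp_all)
        omega
      obtain ⟨b, hb⟩ : ∃ b, b ∉ Finset.univ.image i := by
        by_contra! hcon
        have : Finset.univ.image i = Finset.univ := Finset.eq_univ_of_forall hcon
        rw [this, Finset.card_univ, Fintype.card_fin] at hlt
        omega
      refine hT.apply_eq_zero_of_three_le_card_fiber ha (b := b) (by simpa using hb) ?_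
      intro j hj
      exact ih _ (by have := hle j; omega) j rfl
    · refine h0 i fun x => ?_
      push Not at h1 h3
      have hpos : 0 < (Finset.univ.filter fun r => i r = i x).card :=
        Finset.card_pos.mpr ⟨x, by simp⟩
      have h1x := h1 (i x)
      have h3x := h3 (i x)
      have : Nat.card {y // Setoid.ker i x y} = (Finset.univ.filter fun r => i r = i x).card := by
        rw [Nat.card_eq_fintype_card, Fintype.card_subtype]
        congr 1
        ext r
        simp [Setoid.ker_def, eq_comm]
      exact this.trans (by omega)

/-- First fundamental theorem for the orthogonal group, in the stable range. -/
theorem exists_eq_sum_kerDelta (hT : IsOrthogonalInvariant T) (hsM : s ≤ M) :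
    ∃ c : {π : Setoid (Fin s) // IsPairing π} → ℝ, ∀ i, T i = ∑ π, c π * kerDelta π.1 i := by
  have hrep : ∀ π : Setoid (Fin s), ∃ i : Fin s → Fin M, Setoid.ker i = π := by
    intro π
    have hcard : Fintype.card (Quotient π) ≤ Fintype.card (Fin M) := by
      have := Fintype.card_le_of_surjective (Quotient.mk π) Quotient.mk_surjective
      simp only [Fintype.card_fin] at this ⊢
      omega
    obtain ⟨f⟩ := Function.Embedding.nonempty_of_card_le hcard
    refine ⟨fun x => f (Quotient.mk π x), Setoid.ext fun x y => ?_⟩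
    rw [Setoid.ker_def, f.injective.eq_iff]
    exact Quotient.eq
  choose rep hker using hrep
  refine ⟨fun π => T (rep π.1), fun i => ?_⟩
  have hinv := hT.sub (linearCombination (fun π : {π : Setoid (Fin s) // IsPairing π} =>
    T (rep π.1)) fun π => isOrthogonalInvariant_kerDelta π.2)
  refine sub_eq_zero.mp (hinv.eq_zero_of_pairing hsM (fun j hj => ?_) i)
  rw [Finset.sum_eq_single ⟨Setoid.ker j, hj⟩]
  · simp only [kerDelta, le_refl, if_true, mul_one]
    exact sub_eq_zero.mpr (hT.apply_eq_of_ker_eq (hker _).symm)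
  · intro π _ hne
    rw [kerDelta, if_neg, mul_zero]
    intro hle
    refine hne (Subtype.ext (Setoid.ext fun x y => ⟨fun h => hle h, fun h => ?_⟩))
    have hsub : (Finset.univ.filter fun z => π.1 x z) ⊆
        Finset.univ.filter fun z => Setoid.ker j x z := by
      intro z hz
      simp only [Finset.mem_filter, Finset.mem_univ, true_and] at hz ⊢
      exact hle hz
    have hπ := π.2 x
    have hj' := hj x
    rw [Nat.card_eq_fintype_card, Fintype.card_subtype] at hπ hj'
    have heq := Finset.eq_of_subset_of_card_le hsub (hj'.trans hπ.symm).le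
    have : y ∈ Finset.univ.filter fun z => Setoid.ker j x z := by simpa using h
    rw [← heq] at this
    simpa using this
  · simp

end IsOrthogonalInvariant

/-- The matrix whose columns are the tensors `δ_π`. -/
noncomputable def kerDeltaMatrix (s M : ℕ) :
    Matrix (Fin s → Fin M) {π : Setoid (Fin s) // IsPairing π} ℝ := fun i π => kerDelta π.1 i

theorem kerDeltaMatrix_transpose_mul_self (s M : ℕ) (π σ : {π : Setoid (Fin s) // IsPairing π}) :
    ((kerDeltaMatrix s M)ᵀ * kerDeltaMatrix s M) π σ =
      (M : ℝ) ^ Nat.card (Quotient (π.1 ⊔ σ.1)) := by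
  simpa [Matrix.mul_apply, kerDeltaMatrix] using
    sum_kerDelta_mul_kerDelta (m := Fin M) π.1 σ.1

theorem sum_sum_kerDelta_mul_prod_partialIsometry {s : ℕ} {π σ : Setoid (Fin s)}
    {L M N : ℕ} (hπ : IsPairing π) (hσ : IsPairing σ) {X : Matrix (Fin M) (Fin L) ℝ}
    {Y : Matrix (Fin N) (Fin L) ℝ} (hX : Xᵀ * X = 1) (hY : Yᵀ * Y = 1) :
    ∑ j, ∑ i, kerDelta π i * (∏ r, (X * Yᵀ) (i r) (j r)) * kerDelta σ j =
      (L : ℝ) ^ Nat.card (Quotient (π ⊔ σ)) := by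
  have hXY : (X * Yᵀ)ᵀ * (X * Yᵀ) = Yᵀᵀ * Yᵀ := by
    rw [Matrix.transpose_mul, Matrix.mul_assoc, ← Matrix.mul_assoc Xᵀ, hX, Matrix.one_mul]
  have hY1 : Yᵀ * Y = (1 : Matrix (Fin L) (Fin L) ℝ)ᵀ * 1 := by simpa using hY
  simp only [← Finset.sum_mul, sum_kerDelta_mul_prod_congr hπ hXY]
  simp only [Finset.sum_mul]
  rw [Finset.sum_comm]
  calc _ = ∑ a : Fin s → Fin L, kerDelta π a * kerDelta σ a := by
        refine Finset.sum_congr rfl fun a _ => ?_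
        rw [← sum_kerDelta_mul_prod_one σ a, ← sum_kerDelta_mul_prod_congr hσ hY1 a,
          Finset.mul_sum]
        exact Finset.sum_congr rfl fun j _ => by simp only [Matrix.transpose_apply]; ring
    _ = _ := by simpa using sum_kerDelta_mul_kerDelta (m := Fin L) π σ

/-- A tensor in the span of the `δ_π` is fixed by the associated Weingarten projection. -/
theorem weingarten_projection_mul {s M : ℕ} (hsM : s ≤ M) {n : Type*}
    {F : Matrix (Fin s → Fin M) n ℝ} (hF : ∀ j, IsOrthogonalInvariant fun i => F i j)
    {W : Matrix {π : Setoid (Fin s) // IsPairing π} {π : Setoid (Fin s) // IsPairing π} ℝ}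
    (hW : W * ((kerDeltaMatrix s M)ᵀ * kerDeltaMatrix s M) = 1) :
    kerDeltaMatrix s M * W * (kerDeltaMatrix s M)ᵀ * F = F := by
  choose c hc using fun j => (hF j).exists_eq_sum_kerDelta hsM
  have hFc : F = kerDeltaMatrix s M * Matrix.of fun π j => c j π := by
    ext i j
    rw [hc]
    simp [Matrix.mul_apply, kerDeltaMatrix, mul_comm]
  rw [hFc, Matrix.mul_assoc _ _ (kerDeltaMatrix s M * _), ← Matrix.mul_assoc _ (kerDeltaMatrix s M),
    Matrix.mul_assoc _ W, ← Matrix.mul_assoc W, hW, Matrix.one_mul]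

section Integration

variable {L M N : ℕ}

theorem measurable_orthogonal_sandwich (J : Matrix (Fin M) (Fin N) ℝ) :
    Measurable (fun p : ↥(Matrix.orthogonalGroup (Fin M) ℝ) ×
        ↥(Matrix.orthogonalGroup (Fin N) ℝ) =>
      (p.1 : Matrix (Fin M) (Fin M) ℝ) * J * (p.2 : Matrix (Fin N) (Fin N) ℝ)ᵀ) := by
  refine measurable_pi_lambda _ fun a => measurable_pi_lambda _ fun b => ?_
  simp only [Matrix.mul_apply, Matrix.transpose_apply]
  have h1 : ∀ x y, Measurable fun p : ↥(Matrix.orthogonalGroup (Fin M) ℝ) ×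
      ↥(Matrix.orthogonalGroup (Fin N) ℝ) => (p.1 : Matrix (Fin M) (Fin M) ℝ) x y := fun x y =>
    (measurable_pi_apply y).comp
      ((measurable_pi_apply x).comp (measurable_subtype_coe.comp measurable_fst))
  have h2 : ∀ x y, Measurable fun p : ↥(Matrix.orthogonalGroup (Fin M) ℝ) ×
      ↥(Matrix.orthogonalGroup (Fin N) ℝ) => (p.2 : Matrix (Fin N) (Fin N) ℝ) x y := fun x y =>
    (measurable_pi_apply y).comp
      ((measurable_pi_apply x).comp (measurable_subtype_coe.comp measurable_snd))
  exact Finset.measurable_sum _ fun y _ =>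
    (Finset.measurable_sum _ fun x _ => (h1 _ _).mul_const _).mul (h2 _ _)

theorem measurable_orthogonal_const_mul (g : ↥(Matrix.orthogonalGroup (Fin M) ℝ)) :
    Measurable (fun A : ↥(Matrix.orthogonalGroup (Fin M) ℝ) => g * A) := by
  refine Measurable.subtype_mk (measurable_pi_lambda _ fun a => measurable_pi_lambda _ fun b => ?_)
  simp only [Matrix.mul_apply]
  have hentry : ∀ x, Measurable fun A : ↥(Matrix.orthogonalGroup (Fin M) ℝ) =>
      (A : Matrix (Fin M) (Fin M) ℝ) x b := fun x =>
    (measurable_pi_apply b).comp ((measurable_pi_apply x).comp measurable_subtype_coe)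
  exact Finset.measurable_sum _ fun x _ => (hentry x).const_mul _

theorem exists_norm_orthogonal_sandwich_le (J : Matrix (Fin M) (Fin N) ℝ) :
    ∃ C : ℝ, ∀ (A : ↥(Matrix.orthogonalGroup (Fin M) ℝ))
      (B : ↥(Matrix.orthogonalGroup (Fin N) ℝ)) (a : Fin M) (b : Fin N),
      ‖((A : Matrix (Fin M) (Fin M) ℝ) * J * (B : Matrix (Fin N) (Fin N) ℝ)ᵀ) a b‖ ≤ C := by
  refine ⟨∑ y, ∑ x, ‖J x y‖, fun A B a b => ?_⟩
  simp only [Matrix.mul_apply, Matrix.transpose_apply]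
  refine (norm_sum_le _ _).trans (Finset.sum_le_sum fun y _ => ?_)
  rw [norm_mul]
  refine (mul_le_of_le_one_right (norm_nonneg _)
    (entry_norm_bound_of_unitary B.2 b y)).trans ?_
  refine (norm_sum_le _ _).trans (Finset.sum_le_sum fun x _ => ?_)
  rw [norm_mul]
  exact mul_le_of_le_one_left (norm_nonneg _) (entry_norm_bound_of_unitary A.2 a x)

variable (h : Measure (↥(Matrix.orthogonalGroup (Fin M) ℝ) ×
  ↥(Matrix.orthogonalGroup (Fin N) ℝ)))

theorem integrable_prod_orthogonal_sandwich [IsProbabilityMeasure h] {s : ℕ}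
    (J : Matrix (Fin M) (Fin N) ℝ) (i : Fin s → Fin M) (j : Fin s → Fin N) :
    Integrable (fun p : ↥(Matrix.orthogonalGroup (Fin M) ℝ) ×
        ↥(Matrix.orthogonalGroup (Fin N) ℝ) =>
      ∏ r, ((p.1 : Matrix (Fin M) (Fin M) ℝ) * J *
        (p.2 : Matrix (Fin N) (Fin N) ℝ)ᵀ) (i r) (j r)) h := by
  obtain ⟨C, hC⟩ := exists_norm_orthogonal_sandwich_le J
  refine Integrable.of_bound (C := C ^ s) (Measurable.aestronglyMeasurable ?_)
    (Filter.Eventually.of_forall fun p => ?_)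
  · exact Finset.measurable_prod _ fun r _ => (measurable_pi_apply (j r)).comp
      ((measurable_pi_apply (i r)).comp (measurable_orthogonal_sandwich J))
  · rw [norm_prod]
    refine (Finset.prod_le_prod (fun _ _ => norm_nonneg _)
      fun r _ => hC p.1 p.2 (i r) (j r)).trans ?_
    simp

theorem integral_orthogonal_mul_left_eq_self [h.IsMulLeftInvariant]
    (g : ↥(Matrix.orthogonalGroup (Fin M) ℝ) × ↥(Matrix.orthogonalGroup (Fin N) ℝ))
    {f : ↥(Matrix.orthogonalGroup (Fin M) ℝ) × ↥(Matrix.orthogonalGroup (Fin N) ℝ) → ℝ}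
    (hf : Integrable f h) : ∫ p, f (g * p) ∂h = ∫ p, f p ∂h := by
  have hm : Measurable (fun p : ↥(Matrix.orthogonalGroup (Fin M) ℝ) ×
      ↥(Matrix.orthogonalGroup (Fin N) ℝ) => g * p) :=
    ((measurable_orthogonal_const_mul g.1).comp measurable_fst).prodMk
      ((measurable_orthogonal_const_mul g.2).comp measurable_snd)
  have hmap : Measure.map (fun p => g * p) h = h := Measure.IsMulLeftInvariant.map_mul_left_eq_self g
  conv_rhs => rw [← hmap]
  rw [integral_map hm.aemeasurable (by rw [hmap]; exact hf.aestronglyMeasurable)]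

/-- Mixed moments of the entries of `A * J * Bᵀ`, with `(A, B)` distributed as `h`. -/
noncomputable def sandwichMoment {s : ℕ} (J : Matrix (Fin M) (Fin N) ℝ) :
    Matrix (Fin s → Fin M) (Fin s → Fin N) ℝ := fun i j =>
  ∫ p, ∏ r, ((p.1 : Matrix (Fin M) (Fin M) ℝ) * J *
    (p.2 : Matrix (Fin N) (Fin N) ℝ)ᵀ) (i r) (j r) ∂h

variable [IsProbabilityMeasure h]

theorem kerDeltaMatrix_transpose_mul_sandwichMoment_mul {s : ℕ} (hLM : L ≤ M) (hLN : L ≤ N)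
    {J : Matrix (Fin M) (Fin N) ℝ}
    (hJ : ∀ a b, J a b = if (a : ℕ) = (b : ℕ) ∧ (a : ℕ) < L then 1 else 0)
    (σ ν : {π : Setoid (Fin s) // IsPairing π}) :
    ((kerDeltaMatrix s M)ᵀ * sandwichMoment (s := s) h J * kerDeltaMatrix s N) σ ν =
      (L : ℝ) ^ Nat.card (Quotient (σ.1 ⊔ ν.1)) := by
  let E : ∀ K : ℕ, Matrix (Fin K) (Fin L) ℝ := fun K => Matrix.of fun a l =>
    if (a : ℕ) = l then 1 else 0
  have hE : ∀ K, L ≤ K → (E K)ᵀ * E K = 1 := by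
    intro K hK
    ext l l'
    rw [Matrix.mul_apply, Finset.sum_eq_single (Fin.castLE hK l)]
    · simp [E, Matrix.one_apply, Fin.ext_iff]
    · intro a _ ha
      have : (a : ℕ) ≠ l := fun h => ha (Fin.ext h)
      simp [E, this]
    · simp
  have hJE : J = E M * (E N)ᵀ := by
    ext a b
    rw [hJ, Matrix.mul_apply]
    split_ifs with hab
    · rw [Finset.sum_eq_single ⟨a, hab.2⟩]
      · simp [E, hab.1]
      · intro l _ hl
        have : (a : ℕ) ≠ l := fun h => hl (Fin.ext h.symm)
        simp [E, this]
      · simp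
    · refine (Finset.sum_eq_zero fun l _ => ?_).symm
      simp only [E, Matrix.transpose_apply, Matrix.of_apply, mul_ite, mul_one, mul_zero]
      split_ifs with h1 h2
      · exact absurd ⟨h2.trans h1.symm, h2 ▸ l.2⟩ hab
      all_goals rfl
  have hiso : ∀ (K : ℕ) (A : ↥(Matrix.orthogonalGroup (Fin K) ℝ)), L ≤ K →
      ((A : Matrix (Fin K) (Fin K) ℝ) * E K)ᵀ * ((A : Matrix (Fin K) (Fin K) ℝ) * E K) = 1 := by
    intro K A hK
    have hA : (A : Matrix (Fin K) (Fin K) ℝ)ᵀ * (A : Matrix (Fin K) (Fin K) ℝ) = 1 := by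
      simpa using (Matrix.mem_orthogonalGroup_iff' (Fin K) ℝ).mp A.2
    rw [Matrix.transpose_mul, Matrix.mul_assoc, ← Matrix.mul_assoc _ _ (E K), hA,
      Matrix.one_mul, hE K hK]
  have hpt : ∀ p : ↥(Matrix.orthogonalGroup (Fin M) ℝ) × ↥(Matrix.orthogonalGroup (Fin N) ℝ),
      ∑ j, ∑ i, kerDelta σ.1 i * (∏ r, ((p.1 : Matrix (Fin M) (Fin M) ℝ) * J *
        (p.2 : Matrix (Fin N) (Fin N) ℝ)ᵀ) (i r) (j r)) * kerDelta ν.1 j =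
      (L : ℝ) ^ Nat.card (Quotient (σ.1 ⊔ ν.1)) := by
    intro p
    rw [← sum_sum_kerDelta_mul_prod_partialIsometry σ.2 ν.2 (hiso M p.1 hLM) (hiso N p.2 hLN),
      hJE, Matrix.transpose_mul]
    simp only [Matrix.mul_assoc]
  have hint := fun (i : Fin s → Fin M) (j : Fin s → Fin N) =>
    ((integrable_prod_orthogonal_sandwich h J i j).const_mul (kerDelta σ.1 i)).mul_const
      (kerDelta ν.1 j)
  calc ((kerDeltaMatrix s M)ᵀ * sandwichMoment (s := s) h J * kerDeltaMatrix s N) σ ν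
      = ∑ j, ∑ i, kerDelta σ.1 i * sandwichMoment h J i j * kerDelta ν.1 j := by
        simp only [Matrix.mul_apply, Matrix.transpose_apply, Finset.sum_mul, kerDeltaMatrix]
    _ = ∫ p, ∑ j, ∑ i, kerDelta σ.1 i * (∏ r, ((p.1 : Matrix (Fin M) (Fin M) ℝ) * J *
        (p.2 : Matrix (Fin N) (Fin N) ℝ)ᵀ) (i r) (j r)) * kerDelta ν.1 j ∂h := by
        rw [integral_finsetSum _ fun j _ => integrable_finsetSum _ fun i _ => hint i j]
        refine Finset.sum_congr rfl fun j _ => ?_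
        rw [integral_finsetSum _ fun i _ => hint i j]
        refine Finset.sum_congr rfl fun i _ => ?_
        rw [integral_mul_const, integral_const_mul, sandwichMoment]
    _ = _ := by simp [hpt]

variable [h.IsMulLeftInvariant]

theorem isOrthogonalInvariant_sandwichMoment_left {s : ℕ} (J : Matrix (Fin M) (Fin N) ℝ)
    (j : Fin s → Fin N) : IsOrthogonalInvariant fun i => sandwichMoment h J i j := by
  intro g hg i
  simp only [sandwichMoment]
  rw [← integral_orthogonal_mul_left_eq_self h (⟨g, hg⟩, 1)
    (integrable_prod_orthogonal_sandwich h J i j)]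
  simp only [← integral_const_mul]
  rw [← integral_finsetSum _ fun i' _ =>
    (integrable_prod_orthogonal_sandwich h J i' j).const_mul _]
  refine integral_congr_ae (Filter.Eventually.of_forall fun p => ?_)
  simp only [← Finset.prod_mul_distrib]
  rw [← Fintype.prod_sum fun r x => g (i r) x * ((p.1 : Matrix (Fin M) (Fin M) ℝ) * J *
        (p.2 : Matrix (Fin N) (Fin N) ℝ)ᵀ) x (j r)]
  refine Finset.prod_congr rfl fun r _ => ?_
  rw [← Matrix.mul_apply]
  simp [Matrix.mul_assoc]

theorem isOrthogonalInvariant_sandwichMoment_right {s : ℕ} (J : Matrix (Fin M) (Fin N) ℝ)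
    (i : Fin s → Fin M) : IsOrthogonalInvariant fun j => sandwichMoment h J i j := by
  intro g hg j
  simp only [sandwichMoment]
  rw [← integral_orthogonal_mul_left_eq_self h (1, ⟨g, hg⟩)
    (integrable_prod_orthogonal_sandwich h J i j)]
  simp only [← integral_const_mul]
  rw [← integral_finsetSum _ fun j' _ =>
    (integrable_prod_orthogonal_sandwich h J i j').const_mul _]
  refine integral_congr_ae (Filter.Eventually.of_forall fun p => ?_)
  simp only [← Finset.prod_mul_distrib]
  rw [← Fintype.prod_sum fun r x => g (j r) x * ((p.1 : Matrix (Fin M) (Fin M) ℝ) * J *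
        (p.2 : Matrix (Fin N) (Fin N) ℝ)ᵀ) (i r) x]
  refine Finset.prod_congr rfl fun r _ => ?_
  have : ∀ X : Matrix (Fin M) (Fin N) ℝ, ∑ x, g (j r) x * X (i r) x = (X * gᵀ) (i r) (j r) := by
    intro X
    simp [Matrix.mul_apply, mul_comm]
  rw [this]
  simp [Matrix.mul_assoc]

end Integration

/-- the Weingarten-type integration formula over `O_{MN}^L`.  With `s = 2k`,
`P₂(s)` the pairings of `Fin s`, Gram matrices `G_{sM}(π,σ) = M^{|π⊔σ|}`,
`G_{sN}(π,σ) = N^{|π⊔σ|}` invertible with inverses `W_{sM}`, `W_{sN}`, and `μ` the pushforward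
of the Haar probability measure on `O(M) × O(N)` under `(A,B) ↦ A * J * Bᵀ` (where
`J = fromBlocks 1 0 0 0` has upper-left block the L×L identity), one has, for all multi-indices
`i : Fin s → Fin M` and `j : Fin s → Fin N`:
`∫ ∏_r U (i r) (j r) dμ(U) = ∑_{π,σ,τ,ν ∈ P₂(s)} L^{|σ⊔ν|} δ_π(i) δ_τ(j) W_{sM} π σ W_{sN} τ ν`. -/
theorem stmt_18 (k : ℕ) (hk : 1 ≤ k) (s : ℕ) (hs : s = 2 * k)
    (L M N : ℕ) (hLM : L ≤ M) (hMN : M ≤ N) (hsM : s ≤ M)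
    (G_M G_N W_M W_N : Matrix {π : Setoid (Fin s) // IsPairing π}
      {π : Setoid (Fin s) // IsPairing π} ℝ)
    (hGM : ∀ π σ, G_M π σ = (M : ℝ) ^ Nat.card (Quotient (π.1 ⊔ σ.1)))
    (hGN : ∀ π σ, G_N π σ = (N : ℝ) ^ Nat.card (Quotient (π.1 ⊔ σ.1)))
    (hWM : G_M * W_M = 1 ∧ W_M * G_M = 1) (hWN : G_N * W_N = 1 ∧ W_N * G_N = 1)
    (J : Matrix (Fin M) (Fin N) ℝ)
    (hJ : ∀ a b, J a b = if (a : ℕ) = (b : ℕ) ∧ (a : ℕ) < L then 1 else 0)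
    (h : Measure (↥(Matrix.orthogonalGroup (Fin M) ℝ) × ↥(Matrix.orthogonalGroup (Fin N) ℝ)))
    [IsProbabilityMeasure h] [h.IsMulLeftInvariant] [h.IsMulRightInvariant]
    (μ : Measure (Matrix (Fin M) (Fin N) ℝ))
    (hμ : μ = Measure.map
      (fun p : ↥(Matrix.orthogonalGroup (Fin M) ℝ) × ↥(Matrix.orthogonalGroup (Fin N) ℝ) =>
        (p.1 : Matrix (Fin M) (Fin M) ℝ) * J * (p.2 : Matrix (Fin N) (Fin N) ℝ)ᵀ) h)
    (i : Fin s → Fin M) (j : Fin s → Fin N) :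
    ∫ U, (∏ r, U (i r) (j r)) ∂μ =
      ∑ π : {π : Setoid (Fin s) // IsPairing π}, ∑ σ : {π : Setoid (Fin s) // IsPairing π},
      ∑ τ : {π : Setoid (Fin s) // IsPairing π}, ∑ ν : {π : Setoid (Fin s) // IsPairing π},
        (L : ℝ) ^ Nat.card (Quotient (σ.1 ⊔ ν.1)) *
          (if π.1 ≤ Setoid.ker i then (1 : ℝ) else 0) *
          (if τ.1 ≤ Setoid.ker j then (1 : ℝ) else 0) * W_M π σ * W_N τ ν := by
  have hGM' : G_M = (kerDeltaMatrix s M)ᵀ * kerDeltaMatrix s M := by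
    ext π σ; rw [hGM, kerDeltaMatrix_transpose_mul_self]
  have hGN' : G_N = (kerDeltaMatrix s N)ᵀ * kerDeltaMatrix s N := by
    ext π σ; rw [hGN, kerDeltaMatrix_transpose_mul_self]
  have hWNt : W_Nᵀ = W_N := by
    have hGt : G_Nᵀ = G_N := by rw [hGN', Matrix.transpose_mul, Matrix.transpose_transpose]
    have h1 : W_Nᵀ * G_N = 1 := by
      rw [← hGt, ← Matrix.transpose_mul, hWN.1, Matrix.transpose_one]
    exact left_inv_eq_right_inv h1 hWN.1
  set F : Matrix (Fin s → Fin M) (Fin s → Fin N) ℝ := sandwichMoment h J with hF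
  have hleft : kerDeltaMatrix s M * W_M * (kerDeltaMatrix s M)ᵀ * F = F :=
    weingarten_projection_mul hsM (isOrthogonalInvariant_sandwichMoment_left h J)
      (hGM' ▸ hWM.2)
  have hright : kerDeltaMatrix s N * W_N * (kerDeltaMatrix s N)ᵀ * Fᵀ = Fᵀ :=
    weingarten_projection_mul (hsM.trans hMN) (isOrthogonalInvariant_sandwichMoment_right h J)
      (hGN' ▸ hWN.2)
  have hright' : F * (kerDeltaMatrix s N * W_N * (kerDeltaMatrix s N)ᵀ) = F := by
    have := congrArg Matrix.transpose hright
    simpa [Matrix.transpose_mul, hWNt, Matrix.mul_assoc] using this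
  have hfact : F = kerDeltaMatrix s M * (W_M * ((kerDeltaMatrix s M)ᵀ * F * kerDeltaMatrix s N) *
      W_N) * (kerDeltaMatrix s N)ᵀ := by
    conv_lhs => rw [← hright', ← hleft]
    simp only [Matrix.mul_assoc]
  have hLHS : ∫ U, (∏ r, U (i r) (j r)) ∂μ = F i j := by
    rw [hμ, integral_map (measurable_orthogonal_sandwich J).aemeasurable, hF, sandwichMoment]
    exact (Finset.measurable_prod _ fun r _ => (measurable_pi_apply (j r)).comp
      (measurable_pi_apply (i r))).aestronglyMeasurable
  have hexpand : ∀ X : Matrix {π : Setoid (Fin s) // IsPairing π}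
      {π : Setoid (Fin s) // IsPairing π} ℝ,
      (kerDeltaMatrix s M * (W_M * X * W_N) * (kerDeltaMatrix s N)ᵀ) i j =
        ∑ π, ∑ σ, ∑ τ, ∑ ν, X σ ν * kerDelta π.1 i * kerDelta τ.1 j * W_M π σ * W_N τ ν := by
    intro X
    have hsymm : ∀ τ ν, W_N ν τ = W_N τ ν := fun τ ν => congrFun (congrFun hWNt τ) ν
    rw [show kerDeltaMatrix s M * (W_M * X * W_N) * (kerDeltaMatrix s N)ᵀ =
      kerDeltaMatrix s M * (W_M * (X * (W_N * (kerDeltaMatrix s N)ᵀ))) by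
        simp only [Matrix.mul_assoc]]
    simp only [Matrix.mul_apply, Matrix.transpose_apply, kerDeltaMatrix, Finset.mul_sum]
    refine Finset.sum_congr rfl fun π _ => Finset.sum_congr rfl fun σ _ => ?_
    rw [Finset.sum_comm]
    refine Finset.sum_congr rfl fun τ _ => Finset.sum_congr rfl fun ν _ => ?_
    rw [hsymm]
    ring
  rw [hLHS, hfact, hexpand]
  simp only [hF, kerDeltaMatrix_transpose_mul_sandwichMoment_mul h hLM (hLM.trans hMN) hJ]
  rfl
end
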